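/- arXiv:1412.0080 — 5 statements merged into one kernel-verified Lean document; each statement's English description precedes it below -/
import Mathlib

section
/- Let (X,σ) be an infinite minimal one-sided shift with sublinear complexity. For each k ≥ 2 let M_k denote the number of branch points of order k in X, and let M be the minimum of M_k over those k ≥ 2 for which M_k ≥ 1 (at least one such k exists). Then the automorphism group Aut(X,σ) has at most M elements. -/
/-- The one-sided shift map on `A^ℕ`. -/
def shiftN {A : Type*} (x : ℕ → A) : ℕ → A := fun n => x (n + 1)

/-- The complexity function: the number of words of length `n` occurring in points of `X`. -/
noncomputable def complexityN {A : Type*} [Fintype A] (X : Set (ℕ → A)) (n : ℕ) : ℕ :=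
  Nat.card {w : Fin n → A | ∃ x ∈ X, ∃ i : ℕ, ∀ j : Fin n, w j = x (i + (j : ℕ))}

/-- `X` has sublinear complexity: `p(n) ≤ C n` for all `n ≥ 1`. -/
def SublinearComplexityN {A : Type*} [Fintype A] (X : Set (ℕ → A)) : Prop :=
  ∃ C : ℕ, ∀ n : ℕ, 1 ≤ n → complexityN X n ≤ C * n

/-- Minimality of a one-sided shift: every forward orbit is dense in `X`. -/
def MinimalN {A : Type*} [TopologicalSpace A] (X : Set (ℕ → A)) : Prop :=
  ∀ x ∈ X, X ⊆ closure {y : ℕ → A | ∃ n : ℕ, y = shiftN^[n] x}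

/-- `x` is a branch point of order `k`: it lies in `X` and has exactly `k`
σ-preimages in `X`. -/
def IsBranchPointOfOrder {A : Type*} (X : Set (ℕ → A)) (k : ℕ) (x : ℕ → A) : Prop :=
  x ∈ X ∧ Nat.card {y : ℕ → A // y ∈ X ∧ shiftN y = x} = k

/-- An automorphism of the one-sided shift `(X, σ)`: a continuous bijection of `X`
commuting with the shift. -/
def IsAutN {A : Type*} [TopologicalSpace A] (X : Set (ℕ → A)) (Φ : X → X) : Prop :=
  Continuous Φ ∧ Function.Bijective Φ ∧
    ∀ x y : X, (y : ℕ → A) = shiftN (x : ℕ → A) → (Φ y : ℕ → A) = shiftN (Φ x : ℕ → A)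

namespace ShiftN

variable {A : Type*}

theorem iterate_shiftN_apply (x : ℕ → A) (i n : ℕ) : shiftN^[i] x n = x (i + n) := by
  induction i generalizing n with
  | zero => simp
  | succ i ih =>
    rw [Function.iterate_succ_apply', shiftN, ih, add_right_comm, add_assoc]

theorem iterate_shiftN_mem {X : Set (ℕ → A)} (hinv : ∀ x ∈ X, shiftN x ∈ X) (i : ℕ) :
    ∀ x ∈ X, shiftN^[i] x ∈ X := by
  induction i with
  | zero => exact fun x hx => hx
  | succ i ih => exact fun x hx => ih _ (hinv x hx)

theorem eq_of_apply_zero_eq_of_shiftN_eq {x y : ℕ → A} (h0 : x 0 = y 0)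
    (h : shiftN x = shiftN y) : x = y := by
  funext n
  cases n with
  | zero => exact h0
  | succ n => exact congrFun h n

/-- The words of length `n` occurring in points of `X`. -/
def words (X : Set (ℕ → A)) (n : ℕ) : Set (Fin n → A) :=
  {w | ∃ x ∈ X, ∃ i : ℕ, ∀ j : Fin n, w j = x (i + (j : ℕ))}

theorem initial_mem_words {X : Set (ℕ → A)} {x : ℕ → A} (hx : x ∈ X) (n : ℕ) :
    (fun j : Fin n => x j) ∈ words X n :=
  ⟨x, hx, 0, fun j => by simp⟩

/-- In a minimal shift every word of the language extends to the left. -/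
theorem exists_cons_mem_words [TopologicalSpace A] [DiscreteTopology A] {X : Set (ℕ → A)}
    (hinv : ∀ x ∈ X, shiftN x ∈ X) (hmin : MinimalN X) {n : ℕ} {w : Fin n → A}
    (hw : w ∈ words X n) : ∃ a : A, (Fin.cons a w : Fin (n + 1) → A) ∈ words X (n + 1) := by
  obtain ⟨x, hx, i, hi⟩ := hw
  have hopen : IsOpen {z : ℕ → A | ∀ j : Fin n, z j = w j} := by
    simp only [Set.ofPred_forall]
    exact isOpen_iInter_of_finite fun j =>
      (isOpen_discrete ({w j} : Set A)).preimage
        (f := fun z : ℕ → A => z j) (continuous_apply (j : ℕ))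
  have hcl := hmin _ (hinv x hx) (iterate_shiftN_mem hinv i x hx)
  obtain ⟨z, hz, m, rfl⟩ := mem_closure_iff.1 hcl _ hopen
    (fun j => by rw [iterate_shiftN_apply, hi])
  refine ⟨x m, x, hx, m, fun j => ?_⟩
  refine Fin.cases (by simp) (fun j => ?_) j
  have := hz j
  rw [iterate_shiftN_apply] at this
  rw [Fin.cons_succ, ← this]
  simp only [shiftN, Fin.val_succ]
  congr 1

/-- The points of `X` with at least two preimages in `X`. -/
def branchPoints (X : Set (ℕ → A)) : Set (ℕ → A) :=
  {x | ∃ y ∈ X, ∃ z ∈ X, y ≠ z ∧ shiftN y = x ∧ shiftN z = x}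

theorem cons_initial_shiftN_mem_words {X : Set (ℕ → A)} {y : ℕ → A} (hy : y ∈ X) (n : ℕ) :
    (Fin.cons (y 0) (fun j : Fin n => shiftN y j) : Fin (n + 1) → A) ∈ words X (n + 1) := by
  convert initial_mem_words hy (n + 1) using 1
  funext j
  refine Fin.cases (by simp) (fun j => ?_) j
  simp [shiftN]

/-- Branch points with distinct initial words of length `n` contribute to the growth of complexity. -/
theorem complexityN_add_card_le [Fintype A] [TopologicalSpace A] [DiscreteTopology A]
    {X : Set (ℕ → A)} (hinv : ∀ x ∈ X, shiftN x ∈ X) (hmin : MinimalN X)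
    {S : Finset (ℕ → A)} (hS : (S : Set (ℕ → A)) ⊆ branchPoints X) {n : ℕ}
    (hn : Set.InjOn (fun (x : ℕ → A) (j : Fin n) => x j) S) :
    complexityN X n + S.card ≤ complexityN X (n + 1) := by
  have hext : ∀ w : words X n, ∃ a : A, (Fin.cons a w.1 : Fin (n + 1) → A) ∈ words X (n + 1) :=
    fun w => exists_cons_mem_words hinv hmin w.2
  choose e he using hext
  have hmem : ∀ s : S, (fun j : Fin n => s.1 j) ∈ words X n := fun s => by
    obtain ⟨y, hy, -, -, -, h, -⟩ := hS s.2
    exact h ▸ initial_mem_words (hinv y hy) n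
  have hother : ∀ s : S, ∃ a : A, a ≠ e ⟨_, hmem s⟩ ∧
      (Fin.cons a (fun j : Fin n => s.1 j) : Fin (n + 1) → A) ∈ words X (n + 1) := by
    intro s
    obtain ⟨y, hy, z, hz, hyz, hys, hzs⟩ := hS s.2
    by_cases h : y 0 = e ⟨_, hmem s⟩
    · refine ⟨z 0, fun h' => hyz ?_, ?_⟩
      · exact eq_of_apply_zero_eq_of_shiftN_eq (h.trans h'.symm) (hys.trans hzs.symm)
      · rw [← hzs]
        exact cons_initial_shiftN_mem_words hz n
    · refine ⟨y 0, h, ?_⟩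
      rw [← hys]
      exact cons_initial_shiftN_mem_words hy n
  choose f hf hfm using hother
  let F : words X n ⊕ S → words X (n + 1) :=
    Sum.elim (fun w => ⟨_, he w⟩) (fun s => ⟨_, hfm s⟩)
  have hF : Function.Injective F := by
    rintro (w | s) (w' | s') h
    · have h := congrArg Subtype.val h
      simp only [F, Sum.elim_inl, Fin.cons_inj] at h
      exact congrArg _ (Subtype.ext h.2)
    · have h := congrArg Subtype.val h
      simp only [F, Sum.elim_inl, Sum.elim_inr, Fin.cons_inj] at h
      have hw : w = ⟨_, hmem s'⟩ := Subtype.ext h.2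
      exact absurd (hw ▸ h.1.symm) (hf s')
    · have h := congrArg Subtype.val h
      simp only [F, Sum.elim_inl, Sum.elim_inr, Fin.cons_inj] at h
      have hw : w' = ⟨_, hmem s⟩ := Subtype.ext h.2.symm
      exact absurd (hw ▸ h.1) (hf s)
    · have h := congrArg Subtype.val h
      simp only [F, Sum.elim_inr, Fin.cons_inj] at h
      exact congrArg _ (Subtype.ext (hn s.2 s'.2 h.2))
  have hcard := Nat.card_le_card_of_injective F hF
  rw [Nat.card_sum, Nat.card_eq_fintype_card (α := S), Fintype.card_coe] at hcard
  exact hcard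

theorem eventually_injOn_initial (S : Finset (ℕ → A)) :
    ∀ᶠ n in Filter.atTop, Set.InjOn (fun (x : ℕ → A) (j : Fin n) => x j) S := by
  have h : ∀ x ∈ S, ∀ y ∈ S, ∀ᶠ n : ℕ in Filter.atTop,
      (fun j : Fin n => x j) = (fun j : Fin n => y j) → x = y := by
    intro x _ y _
    by_cases hxy : x = y
    · exact Filter.Eventually.of_forall fun _ _ => hxy
    · obtain ⟨m, hm⟩ := Function.ne_iff.1 hxy
      filter_upwards [Filter.eventually_gt_atTop m] with n hn h
      exact absurd (congrFun h ⟨m, hn⟩) hm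
  have h' := (Filter.eventually_all_finset S).2 fun x hx =>
    (Filter.eventually_all_finset S).2 (h x hx)
  filter_upwards [h'] with n hn x hx y hy hxy
  exact hn x hx y hy hxy

theorem finite_branchPoints [Fintype A] [TopologicalSpace A] [DiscreteTopology A]
    {X : Set (ℕ → A)} (hinv : ∀ x ∈ X, shiftN x ∈ X) (hmin : MinimalN X)
    (hsub : SublinearComplexityN X) : (branchPoints X).Finite := by
  by_contra hinf
  obtain ⟨C, hC⟩ := hsub
  obtain ⟨S, hS, hcard⟩ := Set.Infinite.exists_subset_card_eq hinf (C + 1)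
  obtain ⟨n₀, hn₀⟩ := Filter.eventually_atTop.1 (eventually_injOn_initial S)
  have hgrow : ∀ m : ℕ, m * (C + 1) ≤ complexityN X (n₀ + m) := by
    intro m
    induction m with
    | zero => simp
    | succ m ih =>
      have := complexityN_add_card_le hinv hmin hS (hn₀ (n₀ + m) (by omega))
      rw [hcard] at this
      rw [← add_assoc]
      linarith
  have h₁ := hgrow (C * n₀ + 1)
  have h₂ := hC (n₀ + (C * n₀ + 1)) (by omega)
  nlinarith

/-- A shift in which a bounded window determines the preceding letter is finite. -/
theorem finite_of_window_determines [Fintype A] {X : Set (ℕ → A)}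
    (hinv : ∀ x ∈ X, shiftN x ∈ X) {n : ℕ}
    (h : ∀ x ∈ X, ∀ y ∈ X, (∀ j < n, x (j + 1) = y (j + 1)) → x 0 = y 0) : X.Finite := by
  have hstep : ∀ m : ℕ, ∀ x ∈ X, ∀ y ∈ X, (∀ j < n, x (m + j) = y (m + j)) →
      ∀ j < m + n, x j = y j := by
    intro m
    induction m with
    | zero => simp
    | succ m ih =>
      intro x hx y hy hxy
      have htail : ∀ j < m + n, x (j + 1) = y (j + 1) :=
        ih _ (hinv x hx) _ (hinv y hy) fun j hj => by
          simpa only [shiftN, add_right_comm] using hxy j hj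
      intro j hj
      cases j with
      | zero => exact h x hx y hy fun j hj => htail j (by omega)
      | succ j => exact htail j (by omega)
  by_contra hinf
  obtain ⟨S, hS, hcard⟩ :=
    Set.Infinite.exists_subset_card_eq hinf (Nat.card (Fin n → A) + 1)
  obtain ⟨m, hm⟩ := (eventually_injOn_initial S).exists
  have hlt : Nat.card (Fin n → A) < Nat.card S := by
    rw [Nat.card_eq_fintype_card (α := S), Fintype.card_coe, hcard]
    omega
  have hni : ¬ Function.Injective (fun (s : S) (j : Fin n) => s.1 (m + j)) := fun hi =>
    absurd (Nat.card_le_card_of_injective _ hi) (by omega)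
  obtain ⟨s, t, hst, hne⟩ := Function.not_injective_iff.1 hni
  refine hne (Subtype.ext (hm s.2 t.2 (funext fun j => ?_)))
  exact hstep m _ (hS s.2) _ (hS t.2) (fun i hi => congrFun hst ⟨i, hi⟩) j (by omega)

theorem branchPoints_nonempty [Fintype A] [TopologicalSpace A] [DiscreteTopology A]
    {X : Set (ℕ → A)} (hclosed : IsClosed X) (hinv : ∀ x ∈ X, shiftN x ∈ X)
    (hinf : X.Infinite) : (branchPoints X).Nonempty := by
  let K : ℕ → Set ((ℕ → A) × (ℕ → A)) := fun n =>
    {p | p.1 ∈ X ∧ p.2 ∈ X ∧ p.1 0 ≠ p.2 0 ∧ ∀ j < n, p.1 (j + 1) = p.2 (j + 1)}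
  have hcoord : ∀ (R : A → A → Prop) (j : ℕ),
      IsClosed {p : (ℕ → A) × (ℕ → A) | R (p.1 j) (p.2 j)} := fun R j =>
    (isClosed_discrete {q : A × A | R q.1 q.2}).preimage
      (f := fun p : (ℕ → A) × (ℕ → A) => (p.1 j, p.2 j)) (by fun_prop)
  have hK : ∀ n, IsClosed (K n) := by
    intro n
    have htail : IsClosed {p : (ℕ → A) × (ℕ → A) | ∀ j < n, p.1 (j + 1) = p.2 (j + 1)} := by
      simp only [Set.ofPred_forall]
      exact isClosed_iInter fun j => isClosed_iInter fun _ => hcoord (· = ·) (j + 1)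
    exact (hclosed.preimage continuous_fst).inter ((hclosed.preimage continuous_snd).inter
      ((hcoord (· ≠ ·) 0).inter htail))
  obtain ⟨⟨y, z⟩, hyz⟩ := IsCompact.nonempty_iInter_of_sequence_nonempty_isCompact_isClosed K
    (fun n p hp => ⟨hp.1, hp.2.1, hp.2.2.1, fun j hj => hp.2.2.2 j (by omega)⟩)
    (fun n => by
      by_contra hemp
      refine hinf (finite_of_window_determines hinv (n := n) fun x hx y hy hxy => ?_)
      by_contra hne
      exact hemp ⟨(x, y), hx, hy, hne, hxy⟩)
    (hK 0).isCompact hK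
  rw [Set.mem_iInter] at hyz
  obtain ⟨hy, hz, hne, -⟩ := hyz 0
  refine ⟨shiftN y, y, hy, z, hz, fun h => hne (congrFun h 0), rfl, ?_⟩
  exact funext fun j => ((hyz (j + 1)).2.2.2 j (by omega)).symm

theorem finite_preimages [Finite A] (X : Set (ℕ → A)) (x : ℕ → A) :
    Finite {y : ℕ → A // y ∈ X ∧ shiftN y = x} :=
  Finite.of_injective (fun y : {y : ℕ → A // y ∈ X ∧ shiftN y = x} => y.1 0)
    fun y z h => Subtype.ext (eq_of_apply_zero_eq_of_shiftN_eq h (y.2.2.trans z.2.2.symm))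

theorem IsBranchPointOfOrder.mem_branchPoints {X : Set (ℕ → A)} {k : ℕ} (hk : 2 ≤ k)
    {x : ℕ → A} (hx : IsBranchPointOfOrder X k x) : x ∈ branchPoints X := by
  have hcard := hx.2
  have : Finite {y : ℕ → A // y ∈ X ∧ shiftN y = x} :=
    Nat.finite_of_card_ne_zero (by omega)
  have := Finite.one_lt_card_iff_nontrivial.1 (hcard ▸ hk : 1 < Nat.card _)
  obtain ⟨⟨y, hy⟩, ⟨z, hz⟩, hne⟩ := exists_pair_ne {y : ℕ → A // y ∈ X ∧ shiftN y = x}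
  exact ⟨y, hy.1, z, hz.1, fun h => hne (Subtype.ext h), hy.2, hz.2⟩

/-- Automorphisms preserve the order of branch points. -/
theorem isBranchPointOfOrder_apply [TopologicalSpace A] {X : Set (ℕ → A)}
    (hinv : ∀ x ∈ X, shiftN x ∈ X) {Φ : X → X} (hΦ : IsAutN X Φ) {k : ℕ} {x : X}
    (hx : IsBranchPointOfOrder X k x) : IsBranchPointOfOrder X k (Φ x) := by
  refine ⟨(Φ x).2, hx.2 ▸ (Nat.card_congr (Equiv.ofBijective
    (fun y : {y : ℕ → A // y ∈ X ∧ shiftN y = x} =>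
      (⟨Φ ⟨y.1, y.2.1⟩, (Φ _).2, (hΦ.2.2 ⟨y.1, y.2.1⟩ x y.2.2.symm).symm⟩ :
        {y : ℕ → A // y ∈ X ∧ shiftN y = Φ x})) ⟨?_, ?_⟩)).symm⟩
  · intro y z h
    have h' := hΦ.2.1.1 (Subtype.ext (Subtype.mk.inj h))
    exact Subtype.ext (Subtype.mk.inj h')
  · rintro ⟨z, hz, hzx⟩
    obtain ⟨y, hy⟩ := hΦ.2.1.2 ⟨z, hz⟩
    have hyz : (Φ y : ℕ → A) = z := congrArg Subtype.val hy
    have hs := hΦ.2.2 y ⟨shiftN y, hinv _ y.2⟩ rfl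
    have heq : (⟨shiftN y, hinv _ y.2⟩ : X) = x :=
      hΦ.2.1.1 (Subtype.ext (by rw [hs, hyz, hzx]))
    exact ⟨⟨y, y.2, congrArg Subtype.val heq⟩, Subtype.ext hyz⟩

/-- In a minimal shift an automorphism is determined by its value at one point. -/
theorem IsAutN.eq_of_apply_eq [TopologicalSpace A] [DiscreteTopology A] {X : Set (ℕ → A)}
    (hinv : ∀ x ∈ X, shiftN x ∈ X) (hmin : MinimalN X) {Φ Ψ : X → X} (hΦ : IsAutN X Φ)
    (hΨ : IsAutN X Ψ) {x : X} (h : Φ x = Ψ x) : Φ = Ψ := by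
  have horbit : ∀ n : ℕ, Φ ⟨shiftN^[n] x, iterate_shiftN_mem hinv n x x.2⟩ =
      Ψ ⟨shiftN^[n] x, iterate_shiftN_mem hinv n x x.2⟩ := by
    intro n
    induction n with
    | zero => exact h
    | succ n ih =>
      apply Subtype.ext
      have hs := Function.iterate_succ_apply' shiftN n (x : ℕ → A)
      rw [hΦ.2.2 ⟨_, iterate_shiftN_mem hinv n x x.2⟩ _ hs,
        hΨ.2.2 ⟨_, iterate_shiftN_mem hinv n x x.2⟩ _ hs, ih]
  have hdense : Dense (Set.range fun n : ℕ =>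
      (⟨shiftN^[n] x, iterate_shiftN_mem hinv n x x.2⟩ : X)) := by
    intro y
    rw [closure_subtype]
    refine closure_mono ?_ (hmin x x.2 y.2)
    rintro _ ⟨n, rfl⟩
    exact ⟨_, ⟨n, rfl⟩, rfl⟩
  refine Continuous.ext_on hdense hΦ.1 hΨ.1 ?_
  rintro _ ⟨n, rfl⟩
  exact horbit n

end ShiftN

/-- For an infinite minimal one-sided shift with sublinear complexity,
there is some `k ≥ 2` admitting at least one branch point of order `k`, and for every
such `k` the automorphism group has at most `M_k` elements; hence it has at most
`M = min {M_k : k ≥ 2, M_k ≥ 1}` elements. -/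
theorem aut_card_le_min_branch_points
    {A : Type*} [Fintype A] [TopologicalSpace A] [DiscreteTopology A]
    (X : Set (ℕ → A)) (hne : X.Nonempty) (hclosed : IsClosed X)
    (hinv : ∀ x ∈ X, shiftN x ∈ X)
    (hmin : MinimalN X) (hinf : X.Infinite)
    (hsub : SublinearComplexityN X) :
    (∃ k : ℕ, 2 ≤ k ∧ 1 ≤ Nat.card {x : ℕ → A // IsBranchPointOfOrder X k x}) ∧
      ∀ k : ℕ, 2 ≤ k → 1 ≤ Nat.card {x : ℕ → A // IsBranchPointOfOrder X k x} →
        Finite {Φ : X → X // IsAutN X Φ} ∧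
          Nat.card {Φ : X → X // IsAutN X Φ} ≤
            Nat.card {x : ℕ → A // IsBranchPointOfOrder X k x} := by
  constructor
  · obtain ⟨x, hx⟩ := ShiftN.branchPoints_nonempty hclosed hinv hinf
    have hfin := ShiftN.finite_preimages X x
    obtain ⟨y, hy, z, hz, hne, hyx, hzx⟩ := hx
    have hk : 2 ≤ Nat.card {y : ℕ → A // y ∈ X ∧ shiftN y = x} := by
      have : Nontrivial {y : ℕ → A // y ∈ X ∧ shiftN y = x} :=
        ⟨⟨y, hy, hyx⟩, ⟨z, hz, hzx⟩, fun h => hne (congrArg Subtype.val h)⟩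
      exact Finite.one_lt_card
    refine ⟨_, hk, ?_⟩
    have : Finite {x' : ℕ → A // IsBranchPointOfOrder X
        (Nat.card {y : ℕ → A // y ∈ X ∧ shiftN y = x}) x'} :=
      ((ShiftN.finite_branchPoints hinv hmin hsub).subset
        fun _ => ShiftN.IsBranchPointOfOrder.mem_branchPoints hk).to_subtype
    have : Nonempty {x' : ℕ → A // IsBranchPointOfOrder X
        (Nat.card {y : ℕ → A // y ∈ X ∧ shiftN y = x}) x'} :=
      ⟨⟨x, hyx ▸ hinv y hy, rfl⟩⟩
    exact Nat.card_pos
  · intro k _ hcard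
    obtain ⟨⟨⟨x, hx⟩⟩, hfin⟩ := Nat.card_pos_iff.1 hcard
    let valueAt : {Φ : X → X // IsAutN X Φ} → {x : ℕ → A // IsBranchPointOfOrder X k x} :=
      fun Φ => ⟨Φ.1 ⟨x, hx.1⟩, ShiftN.isBranchPointOfOrder_apply hinv Φ.2 hx⟩
    have hinj : Function.Injective valueAt := fun Φ Ψ h =>
      Subtype.ext (ShiftN.IsAutN.eq_of_apply_eq hinv hmin Φ.2 Ψ.2
        (Subtype.ext (Subtype.mk.inj h)))
    exact ⟨Finite.of_injective valueAt hinj, Nat.card_le_card_of_injective valueAt hinj⟩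
end

section
/- Let (X,σ) be an infinite minimal one-sided shift with sublinear complexity, and let M be the minimum, over those k ≥ 2 for which X has at least one branch point of order k, of the number M_k of branch points of order k. Then every automorphism Φ of (X,σ) has finite order at most M, i.e., Φ^m is the identity for some m with 1 ≤ m ≤ M. -/
/-- The first `n` letters of `x`. -/
def initialWord {A : Type*} (n : ℕ) (x : ℕ → A) : Fin n → A := fun j => x j

lemma initialWord_eq_iff {A : Type*} {n : ℕ} {x y : ℕ → A} :
    initialWord n x = initialWord n y ↔ ∀ i < n, x i = y i :=
  ⟨fun h i hi => congrFun h ⟨i, hi⟩, fun h => funext fun j => h j j.2⟩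

lemma shiftN_iterate_apply {A : Type*} (x : ℕ → A) (n i : ℕ) :
    shiftN^[n] x i = x (i + n) := by
  induction n generalizing x with
  | zero => rfl
  | succ n ih => rw [Function.iterate_succ_apply, ih, shiftN]; rfl

lemma continuous_initialWord {A : Type*} [TopologicalSpace A] (n : ℕ) :
    Continuous (initialWord n : (ℕ → A) → Fin n → A) :=
  continuous_pi fun j => continuous_apply (j : ℕ)

lemma eq_of_shiftN_eq {A : Type*} {x y : ℕ → A} (h : shiftN x = shiftN y) (h0 : x 0 = y 0) :
    x = y := by
  funext n
  cases n with
  | zero => exact h0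
  | succ n => exact congrFun h n

lemma shiftN_iterate_mem {A : Type*} {X : Set (ℕ → A)} (hinv : ∀ x ∈ X, shiftN x ∈ X)
    {x : ℕ → A} (hx : x ∈ X) (n : ℕ) : shiftN^[n] x ∈ X := by
  induction n with
  | zero => exact hx
  | succ n ih => rw [Function.iterate_succ_apply']; exact hinv _ ih

lemma complexityN_eq_card_initialWord {A : Type*} [Fintype A] {X : Set (ℕ → A)}
    (hinv : ∀ x ∈ X, shiftN x ∈ X) (n : ℕ) :
    complexityN X n = Nat.card (initialWord n '' X) := by
  unfold complexityN
  congr 2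
  ext w
  constructor
  · rintro ⟨x, hx, i, h⟩
    refine ⟨shiftN^[i] x, shiftN_iterate_mem hinv hx i, funext fun j => ?_⟩
    rw [h j, initialWord, shiftN_iterate_apply, add_comm]
  · rintro ⟨x, hx, rfl⟩
    exact ⟨x, hx, 0, fun j => by simp [initialWord]⟩

/-- Finitely many points are separated by their initial words of all large lengths. -/
lemma exists_injOn_initialWord {A : Type*} {F : Set (ℕ → A)} (hF : F.Finite) :
    ∃ N, ∀ n ≥ N, Set.InjOn (initialWord n) F := by
  have key : ∀ p : (ℕ → A) × (ℕ → A), ∃ N, ∀ n ≥ N,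
      initialWord n p.1 = initialWord n p.2 → p.1 = p.2 := by
    intro p
    by_cases h : p.1 = p.2
    · exact ⟨0, fun _ _ _ => h⟩
    · obtain ⟨i, hi⟩ := Function.ne_iff.1 h
      exact ⟨i + 1, fun n hn he => absurd (initialWord_eq_iff.1 he i (by omega)) hi⟩
  choose N hN using key
  obtain ⟨M, hM⟩ := ((hF.prod hF).image N).bddAbove
  exact ⟨M, fun n hn x hx y hy h => hN (x, y) n
    ((hM ⟨(x, y), ⟨hx, hy⟩, rfl⟩).trans hn) h⟩

/-- In a minimal shift, every initial word of a point is preceded by some letter. -/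
lemma MinimalN.exists_initialWord_shiftN {A : Type*} [TopologicalSpace A] [DiscreteTopology A]
    {X : Set (ℕ → A)} (hmin : MinimalN X) (hinv : ∀ x ∈ X, shiftN x ∈ X) (n : ℕ)
    {x : ℕ → A} (hx : x ∈ X) :
    ∃ y ∈ X, initialWord n (shiftN y) = initialWord n x := by
  have hopen : IsOpen {y : ℕ → A | initialWord n y = initialWord n x} :=
    (isOpen_discrete {initialWord n x}).preimage (continuous_initialWord n)
  obtain ⟨y, hy, m, rfl⟩ := mem_closure_iff.1 (hmin _ (hinv x hx) hx) _ hopen rfl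
  refine ⟨shiftN^[m] x, shiftN_iterate_mem hinv hx m, ?_⟩
  rw [← Function.iterate_succ_apply' shiftN, Function.iterate_succ_apply]
  exact hy

/-- Points of `X` with several preimages contribute to the growth of the complexity. -/
lemma complexityN_add_card_le {A : Type*} [Fintype A] [TopologicalSpace A] [DiscreteTopology A]
    {X : Set (ℕ → A)} (hinv : ∀ x ∈ X, shiftN x ∈ X) (hmin : MinimalN X)
    {F : Finset (ℕ → A)}
    (hF : ∀ x ∈ F, ∃ y ∈ X, ∃ z ∈ X, y ≠ z ∧ shiftN y = x ∧ shiftN z = x)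
    {n : ℕ} (hn : Set.InjOn (initialWord n) (F : Set (ℕ → A))) :
    complexityN X n + F.card ≤ complexityN X (n + 1) := by
  have hs : ∀ w : initialWord n '' X, ∃ y ∈ X, initialWord n (shiftN y) = w := by
    rintro ⟨_, x, hx, rfl⟩
    exact hmin.exists_initialWord_shiftN hinv n hx
  choose s hsX hs using hs
  have ht : ∀ b : F, ∃ y ∈ X, shiftN y = b ∧
      ∀ w : initialWord n '' X, (w : Fin n → A) = initialWord n (b : ℕ → A) → s w 0 ≠ y 0 := by
    rintro ⟨b, hb⟩
    obtain ⟨y, hy, z, hz, hyz, rfl, hzy⟩ := hF b hb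
    have h0 : y 0 ≠ z 0 := fun h => hyz (eq_of_shiftN_eq hzy.symm h)
    let w₀ : initialWord n '' X := ⟨initialWord n (shiftN y), _, hinv y hy, rfl⟩
    by_cases h : s w₀ 0 = y 0
    · exact ⟨z, hz, hzy, fun w hw => (Subtype.ext hw : w = w₀) ▸ h ▸ h0⟩
    · exact ⟨y, hy, rfl, fun w hw => (Subtype.ext hw : w = w₀) ▸ h⟩
  choose t htX ht hst using ht
  have tail : ∀ {x y : ℕ → A}, initialWord (n + 1) x = initialWord (n + 1) y →
      initialWord n (shiftN x) = initialWord n (shiftN y) := fun h =>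
    initialWord_eq_iff.2 fun i hi => initialWord_eq_iff.1 h (i + 1) (by omega)
  let f : (initialWord n '' X) ⊕ F → initialWord (n + 1) '' X :=
    Sum.elim (fun w => ⟨_, s w, hsX w, rfl⟩) (fun b => ⟨_, t b, htX b, rfl⟩)
  have hst' : ∀ w b, initialWord (n + 1) (s w) ≠ initialWord (n + 1) (t b) := by
    intro w b h
    refine hst b w ?_ (initialWord_eq_iff.1 h 0 (by omega))
    rw [← hs w, tail h, ht]
  have hf : Function.Injective f := by
    rintro (w | b) (w' | b') h <;> replace h := congrArg Subtype.val h
    · exact congrArg _ (Subtype.ext (by rw [← hs w, ← hs w', tail h]))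
    · exact absurd h (hst' _ _)
    · exact absurd h.symm (hst' _ _)
    · refine congrArg _ (Subtype.ext (hn b.2 b'.2 ?_))
      rw [← ht b, ← ht b', tail h]
  have := Nat.card_le_card_of_injective f hf
  rw [Nat.card_sum] at this
  simpa [complexityN_eq_card_initialWord hinv] using this

/-- A minimal shift of sublinear complexity has finitely many points with several preimages. -/
lemma SublinearComplexityN.finite_setOf_branch {A : Type*} [Fintype A] [TopologicalSpace A]
    [DiscreteTopology A] {X : Set (ℕ → A)} (hsub : SublinearComplexityN X)
    (hinv : ∀ x ∈ X, shiftN x ∈ X) (hmin : MinimalN X) :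
    {x : ℕ → A | ∃ y ∈ X, ∃ z ∈ X, y ≠ z ∧ shiftN y = x ∧ shiftN z = x}.Finite := by
  by_contra hinf
  obtain ⟨C, hC⟩ := hsub
  obtain ⟨F, hFB, hFc⟩ := Set.Infinite.exists_subset_card_eq hinf (C + 1)
  obtain ⟨N, hN⟩ := exists_injOn_initialWord F.finite_toSet
  have grow : ∀ m, m * (C + 1) ≤ complexityN X (N + m) := by
    intro m
    induction m with
    | zero => simp
    | succ m ih =>
      have := complexityN_add_card_le hinv hmin (fun x hx => hFB hx) (hN (N + m) (by omega))
      rw [hFc] at this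
      rw [← add_assoc]
      linarith
  have h₁ := grow (C * N + 1)
  have h₂ := hC (N + (C * N + 1)) (by omega)
  nlinarith

/-- If the shift is injective on `X`, boundedly many letters of `shiftN x` determine `x 0`. -/
lemma exists_initialWord_determines {A : Type*} [Finite A] [TopologicalSpace A]
    [DiscreteTopology A] {X : Set (ℕ → A)} (hclosed : IsClosed X) (hinj : Set.InjOn shiftN X) :
    ∃ n, ∀ x ∈ X, ∀ y ∈ X, initialWord n (shiftN x) = initialWord n (shiftN y) → x 0 = y 0 := by
  by_contra! h
  let S : ℕ → Set ((ℕ → A) × (ℕ → A)) := fun n =>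
    X ×ˢ X ∩ {p | initialWord n (shiftN p.1) = initialWord n (shiftN p.2)} ∩ {p | p.1 0 ≠ p.2 0}
  have hcw : ∀ n, Continuous fun x : ℕ → A => initialWord n (shiftN x) := fun n =>
    continuous_pi fun j => continuous_apply ((j : ℕ) + 1)
  have hS : ∀ n, IsClosed (S n) := by
    intro n
    refine ((hclosed.prod hclosed).inter (isClosed_eq ((hcw n).comp continuous_fst)
      ((hcw n).comp continuous_snd))).inter ?_
    have hc : Continuous fun p : (ℕ → A) × (ℕ → A) => (p.1 0, p.2 0) := by fun_prop
    exact (isClosed_discrete {q : A × A | q.1 ≠ q.2}).preimage hc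
  obtain ⟨⟨x, y⟩, hp⟩ := IsCompact.nonempty_iInter_of_sequence_nonempty_isCompact_isClosed S
    (fun n p hp => ⟨⟨hp.1.1, initialWord_eq_iff.2 fun i hi =>
      initialWord_eq_iff.1 hp.1.2 i (by omega)⟩, hp.2⟩)
    (fun n => by
      obtain ⟨x, hx, y, hy, hw, h0⟩ := h n
      exact ⟨(x, y), ⟨⟨hx, hy⟩, hw⟩, h0⟩)
    (hS 0).isCompact hS
  rw [Set.mem_iInter] at hp
  refine (hp 0).2 (congrFun (hinj (hp 0).1.1.1 (hp 0).1.1.2 (funext fun i => ?_)) 0)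
  exact initialWord_eq_iff.1 (hp (i + 1)).1.2 i (by omega)

/-- The shift is not injective on an infinite one-sided shift. -/
lemma not_injOn_shiftN {A : Type*} [Fintype A] [TopologicalSpace A] [DiscreteTopology A]
    {X : Set (ℕ → A)} (hclosed : IsClosed X) (hinv : ∀ x ∈ X, shiftN x ∈ X)
    (hinf : X.Infinite) : ¬ Set.InjOn shiftN X := by
  intro hinj
  obtain ⟨n, hn⟩ := exists_initialWord_determines hclosed hinj
  have pull : ∀ m, ∀ x ∈ X, ∀ y ∈ X,
      initialWord n (shiftN^[m] x) = initialWord n (shiftN^[m] y) →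
      initialWord (n + m) x = initialWord (n + m) y := by
    intro m
    induction m with
    | zero => exact fun x _ y _ h => h
    | succ m ih =>
      intro x hx y hy h
      have hs := initialWord_eq_iff.1 (ih _ (hinv x hx) _ (hinv y hy) h)
      have h0 := hn x hx y hy (initialWord_eq_iff.2 fun i hi => hs i (by omega))
      refine initialWord_eq_iff.2 fun i hi => ?_
      cases i with
      | zero => exact h0
      | succ i => exact hs i (by omega)
  obtain ⟨F, hFX, hFc⟩ := hinf.exists_subset_card_eq (Fintype.card (Fin n → A) + 1)
  obtain ⟨N, hN⟩ := exists_injOn_initialWord F.finite_toSet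
  obtain ⟨x, hx, y, hy, hxy, h⟩ := Finset.exists_ne_map_eq_of_card_lt_of_maps_to
    (s := F) (t := Finset.univ) (f := fun x => initialWord n (shiftN^[N] x))
    (by rw [hFc, Finset.card_univ]; omega) (fun _ _ => Finset.mem_coe.2 (Finset.mem_univ _))
  exact hxy (hN (n + N) (by omega) hx hy (pull N x (hFX hx) y (hFX hy) h))

lemma finite_preimages {A : Type*} [Finite A] (X : Set (ℕ → A)) (x : ℕ → A) :
    Finite {y : ℕ → A // y ∈ X ∧ shiftN y = x} :=
  Finite.of_injective (fun y => y.1 0) fun y z h =>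
    Subtype.ext (eq_of_shiftN_eq (y.2.2.trans z.2.2.symm) h)

/-- An automorphism preserves the order of branch points. -/
lemma IsAutN.isBranchPointOfOrder {A : Type*} [TopologicalSpace A] {X : Set (ℕ → A)}
    {Φ : X → X} (hΦ : IsAutN X Φ) (hinv : ∀ x ∈ X, shiftN x ∈ X) {k : ℕ} {b : X}
    (hb : IsBranchPointOfOrder X k b) : IsBranchPointOfOrder X k (Φ b) := by
  obtain ⟨-, hbij, hcomm⟩ := hΦ
  refine ⟨(Φ b).2, ?_⟩
  rw [← hb.2]
  symm
  refine Nat.card_eq_of_bijective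
    (fun y => ⟨Φ ⟨y.1, y.2.1⟩, (Φ ⟨y.1, y.2.1⟩).2, (hcomm ⟨y.1, y.2.1⟩ b y.2.2.symm).symm⟩)
    ⟨fun y z h => ?_, ?_⟩
  · have h' := hbij.1 (Subtype.ext (Subtype.mk.inj h))
    exact Subtype.ext (Subtype.mk.inj h')
  · rintro ⟨y, hy, hyb⟩
    obtain ⟨z, hz⟩ := hbij.2 ⟨y, hy⟩
    have h := hcomm z ⟨shiftN z, hinv z z.2⟩ rfl
    have hzb : (⟨shiftN z, hinv z z.2⟩ : X) = b :=
      hbij.1 (Subtype.ext (by rw [h, hz]; exact hyb))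
    exact ⟨⟨z, z.2, congrArg Subtype.val hzb⟩, Subtype.ext (congrArg (fun w : X => (w : ℕ → A)) hz)⟩

lemma IsAutN.iterate_shiftN {A : Type*} [TopologicalSpace A] {X : Set (ℕ → A)}
    {Φ : X → X} (hΦ : IsAutN X Φ) (m : ℕ) (x y : X) (h : (y : ℕ → A) = shiftN x) :
    (Φ^[m] y : ℕ → A) = shiftN (Φ^[m] x) := by
  induction m generalizing x y with
  | zero => exact h
  | succ m ih => exact ih _ _ (hΦ.2.2 x y h)

/-- A power of an automorphism of a minimal shift that fixes a point is the identity. -/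
lemma IsAutN.iterate_eq_self {A : Type*} [TopologicalSpace A] [DiscreteTopology A]
    {X : Set (ℕ → A)} {Φ : X → X} (hΦ : IsAutN X Φ) (hmin : MinimalN X)
    (hinv : ∀ x ∈ X, shiftN x ∈ X) {m : ℕ} {b : X} (hb : Φ^[m] b = b) (x : X) :
    Φ^[m] x = x := by
  have orbit : ∀ n, Φ^[m] ⟨shiftN^[n] b, shiftN_iterate_mem hinv b.2 n⟩ =
      ⟨shiftN^[n] b, shiftN_iterate_mem hinv b.2 n⟩ := by
    intro n
    induction n with
    | zero => exact hb
    | succ n ih =>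
      refine Subtype.ext ?_
      rw [hΦ.iterate_shiftN m ⟨shiftN^[n] b, shiftN_iterate_mem hinv b.2 n⟩ _
        (Function.iterate_succ_apply' _ _ _), ih]
      exact (Function.iterate_succ_apply' _ _ _).symm
  have hcl : IsClosed {x : X | Φ^[m] x = x} := isClosed_eq (hΦ.1.iterate m) continuous_id
  refine hcl.closure_subset (closure_subtype.2 (closure_mono ?_ (hmin b b.2 x.2)))
  rintro _ ⟨n, rfl⟩
  exact ⟨_, orbit n, rfl⟩

/-- For an infinite minimal one-sided shift with sublinear complexity,
some `k ≥ 2` admits branch points of order `k`, and for every such `k`, every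
automorphism `Φ` has finite order `m` with `1 ≤ m ≤ M_k`; hence its order is at most
the minimum `M` of the `M_k`. -/
theorem aut_order_le_min_branch_points
    {A : Type*} [Fintype A] [TopologicalSpace A] [DiscreteTopology A]
    (X : Set (ℕ → A)) (hne : X.Nonempty) (hclosed : IsClosed X)
    (hinv : ∀ x ∈ X, shiftN x ∈ X)
    (hmin : MinimalN X) (hinf : X.Infinite)
    (hsub : SublinearComplexityN X) :
    (∃ k : ℕ, 2 ≤ k ∧ 1 ≤ Nat.card {x : ℕ → A // IsBranchPointOfOrder X k x}) ∧
      ∀ Φ : X → X, IsAutN X Φ →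
        ∀ k : ℕ, 2 ≤ k → 1 ≤ Nat.card {x : ℕ → A // IsBranchPointOfOrder X k x} →
          ∃ m : ℕ, 1 ≤ m ∧ m ≤ Nat.card {x : ℕ → A // IsBranchPointOfOrder X k x} ∧
            ∀ x : X, Φ^[m] x = x := by
  refine ⟨?_, fun Φ hΦ k _ hcard => ?_⟩
  · obtain ⟨y, hy, z, hz, hyz, hne'⟩ : ∃ y ∈ X, ∃ z ∈ X, shiftN y = shiftN z ∧ y ≠ z := by
      simpa [Set.InjOn] using not_injOn_shiftN hclosed hinv hinf
    have hfin := hsub.finite_setOf_branch hinv hmin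
    have := finite_preimages X (shiftN y)
    have two : 2 ≤ Nat.card {w : ℕ → A // w ∈ X ∧ shiftN w = shiftN y} :=
      Finite.one_lt_card_iff_nontrivial.2
        ⟨⟨y, hy, rfl⟩, ⟨z, hz, hyz.symm⟩, fun h => hne' (congrArg Subtype.val h)⟩
    refine ⟨_, two, ?_⟩
    have hsubset : {x | IsBranchPointOfOrder X
        (Nat.card {w : ℕ → A // w ∈ X ∧ shiftN w = shiftN y}) x} ⊆
        {x : ℕ → A | ∃ y ∈ X, ∃ z ∈ X, y ≠ z ∧ shiftN y = x ∧ shiftN z = x} := by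
      rintro x ⟨-, hx⟩
      have := finite_preimages X x
      obtain ⟨⟨u, hu⟩, ⟨v, hv⟩, huv⟩ := Finite.one_lt_card_iff_nontrivial.1 (two.trans_eq hx.symm)
      exact ⟨u, hu.1, v, hv.1, fun h => huv (Subtype.ext h), hu.2, hv.2⟩
    have : Finite {x // IsBranchPointOfOrder X _ x} := (hfin.subset hsubset).to_subtype
    exact Finite.card_pos_iff.2 ⟨⟨shiftN y, hinv y hy, rfl⟩⟩
  · have := Nat.finite_of_card_ne_zero (Nat.one_le_iff_ne_zero.1 hcard)
    have := Fintype.ofFinite {x : ℕ → A // IsBranchPointOfOrder X k x}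
    obtain ⟨⟨b, hb⟩⟩ := (Finite.card_pos_iff (α := {x // IsBranchPointOfOrder X k x})).1 hcard
    have hiter : ∀ i, IsBranchPointOfOrder X k (Φ^[i] ⟨b, hb.1⟩) := by
      intro i
      induction i with
      | zero => exact hb
      | succ i ih =>
        rw [Function.iterate_succ_apply']
        exact hΦ.isBranchPointOfOrder hinv ih
    rw [Nat.card_eq_fintype_card]
    obtain ⟨i, j, hij, h⟩ := Fintype.exists_ne_map_eq_of_card_lt
      (fun i : Fin (Fintype.card {x : ℕ → A // IsBranchPointOfOrder X k x} + 1) =>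
        (⟨_, hiter i⟩ : {x : ℕ → A // IsBranchPointOfOrder X k x})) (by simp)
    wlog hlt : i < j generalizing i j
    · exact this j i hij.symm h.symm (lt_of_le_of_ne (not_lt.1 hlt) hij.symm)
    have hlt' : (i : ℕ) < j := hlt
    have hj := j.2
    refine ⟨j - i, by omega, by omega, ?_⟩
    refine hΦ.iterate_eq_self hmin hinv (b := ⟨b, hb.1⟩) (hΦ.2.1.1.iterate i ?_)
    rw [← Function.iterate_add_apply, Nat.add_sub_cancel' hlt'.le]
    exact (Subtype.ext (Subtype.mk.inj h)).symm
end

section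
/- Let (X̄,σ̄) be an infinite minimal two-sided shift with sublinear complexity. For each k ≥ 2 let M̄_k denote the number of ∼-equivalence classes of right asymptotic orbits having exactly k elements, and let M̄ be the minimum of M̄_k over those k ≥ 2 for which M̄_k ≥ 1 (at least one such k exists). Then the quotient group Aut(X̄,σ̄)/{σ̄ⁿ} has at most M̄ elements. -/
/-- The two-sided shift map on `A^ℤ`. -/
def shiftZ {A : Type*} (x : ℤ → A) : ℤ → A := fun n => x (n + 1)

/-- The `n`-th power of the two-sided shift, `n ∈ ℤ`. -/
def shiftZIter {A : Type*} (n : ℤ) (x : ℤ → A) : ℤ → A := fun m => x (m + n)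

/-- The (two-sided) shift orbit of a point. -/
def orbitZ {A : Type*} (x : ℤ → A) : Set (ℤ → A) :=
  Set.range fun n : ℤ => shiftZIter n x

/-- Two points of `A^ℤ` are right asymptotic if they eventually agree to the right. -/
def RightAsymptotic {A : Type*} (x y : ℤ → A) : Prop :=
  ∃ N : ℤ, ∀ n : ℤ, N ≤ n → x n = y n

/-- Two (sets thought of as) orbits contain right asymptotic points. -/
def OrbitsContainRA {A : Type*} (O O' : Set (ℤ → A)) : Prop :=
  ∃ p ∈ O, ∃ q ∈ O', RightAsymptotic p q

/-- `O` is a right asymptotic orbit of `X`: it is the orbit of a point of `X` and it is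
right asymptotic to some orbit of a point of `X` disjoint from it. -/
def IsRAOrbit {A : Type*} (X : Set (ℤ → A)) (O : Set (ℤ → A)) : Prop :=
  (∃ x ∈ X, O = orbitZ x) ∧
    ∃ y ∈ X, O ∩ orbitZ y = ∅ ∧ OrbitsContainRA O (orbitZ y)

/-- The relation `∼` on right asymptotic orbits: equal, or (distinct and) containing
right asymptotic points. -/
def SimRA {A : Type*} (O O' : Set (ℤ → A)) : Prop :=
  O = O' ∨ OrbitsContainRA O O'

/-- The `∼`-class of the orbit `O` among the right asymptotic orbits of `X`. -/
def SimClass {A : Type*} (X : Set (ℤ → A)) (O : Set (ℤ → A)) : Set (Set (ℤ → A)) :=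
  {O' | IsRAOrbit X O' ∧ SimRA O O'}

/-- The number of `∼`-equivalence classes of right asymptotic orbits of `X`
having exactly `k` elements. -/
noncomputable def numRAClassesOfSize {A : Type*} (X : Set (ℤ → A)) (k : ℕ) : ℕ :=
  Nat.card {C : Set (Set (ℤ → A)) //
    (∃ O, IsRAOrbit X O ∧ C = SimClass X O) ∧ C.ncard = k}

/-- The complexity function of a two-sided shift. -/
noncomputable def complexityZ {A : Type*} [Fintype A] (X : Set (ℤ → A)) (n : ℕ) : ℕ :=
  Nat.card {w : Fin n → A | ∃ x ∈ X, ∃ i : ℤ, ∀ j : Fin n, w j = x (i + (j : ℕ))}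

/-- Sublinear complexity for a two-sided shift. -/
def SublinearComplexityZ {A : Type*} [Fintype A] (X : Set (ℤ → A)) : Prop :=
  ∃ C : ℕ, ∀ n : ℕ, 1 ≤ n → complexityZ X n ≤ C * n

/-- Minimality of a two-sided shift: every orbit is dense in `X`. -/
def MinimalZ {A : Type*} [TopologicalSpace A] (X : Set (ℤ → A)) : Prop :=
  ∀ x ∈ X, X ⊆ closure (orbitZ x)

/-- An automorphism of the two-sided shift `(X, σ̄)`: a self-homeomorphism of `X`
commuting with the shift. -/
def IsAutZ {A : Type*} [TopologicalSpace A] (X : Set (ℤ → A)) (Φ : X ≃ₜ X) : Prop :=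
  ∀ x y : X, (y : ℤ → A) = shiftZ (x : ℤ → A) → (Φ y : ℤ → A) = shiftZ (Φ x : ℤ → A)

open Filter Topology

section Shift

variable {A : Type*}

theorem shiftZIter_apply (n : ℤ) (x : ℤ → A) (m : ℤ) : shiftZIter n x m = x (m + n) := rfl

theorem shiftZIter_shiftZIter (m n : ℤ) (x : ℤ → A) :
    shiftZIter m (shiftZIter n x) = shiftZIter (m + n) x := by
  funext i
  simp only [shiftZIter_apply]
  congr 1
  ring

theorem shiftZIter_zero (x : ℤ → A) : shiftZIter 0 x = x := by
  funext i
  simp [shiftZIter_apply]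

theorem shiftZIter_mem_orbitZ (n : ℤ) (x : ℤ → A) : shiftZIter n x ∈ orbitZ x := ⟨n, rfl⟩

theorem mem_orbitZ_self (x : ℤ → A) : x ∈ orbitZ x := ⟨0, shiftZIter_zero x⟩

theorem orbitZ_shiftZIter (n : ℤ) (x : ℤ → A) : orbitZ (shiftZIter n x) = orbitZ x := by
  ext y
  constructor
  · rintro ⟨m, rfl⟩
    exact ⟨m + n, (shiftZIter_shiftZIter m n x).symm⟩
  · rintro ⟨m, rfl⟩
    exact ⟨m - n, by simp [shiftZIter_shiftZIter]⟩

theorem orbitZ_inter_eq_empty_iff (x y : ℤ → A) :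
    orbitZ x ∩ orbitZ y = ∅ ↔ orbitZ x ≠ orbitZ y := by
  constructor
  · intro h he
    have : x ∈ orbitZ x ∩ orbitZ y := ⟨mem_orbitZ_self x, he ▸ mem_orbitZ_self x⟩
    simp [h] at this
  · intro h
    rw [Set.eq_empty_iff_forall_notMem]
    rintro _ ⟨⟨m, rfl⟩, ⟨n, hn⟩⟩
    apply h
    rw [← orbitZ_shiftZIter m x, ← orbitZ_shiftZIter n y]
    exact congrArg orbitZ hn.symm

theorem RightAsymptotic.symm {x y : ℤ → A} (h : RightAsymptotic x y) : RightAsymptotic y x :=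
  h.imp fun _ hN n hn => (hN n hn).symm

theorem RightAsymptotic.trans {x y z : ℤ → A} (h : RightAsymptotic x y)
    (h' : RightAsymptotic y z) : RightAsymptotic x z := by
  obtain ⟨N, hN⟩ := h
  obtain ⟨M, hM⟩ := h'
  exact ⟨max N M, fun n hn => (hN n (le_of_max_le_left hn)).trans (hM n (le_of_max_le_right hn))⟩

theorem RightAsymptotic.shiftZIter {x y : ℤ → A} (h : RightAsymptotic x y) (n : ℤ) :
    RightAsymptotic (shiftZIter n x) (shiftZIter n y) := by
  obtain ⟨N, hN⟩ := h
  exact ⟨N - n, fun m hm => hN _ (by omega)⟩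

theorem orbitsContainRA_orbitZ_iff {x y : ℤ → A} :
    OrbitsContainRA (orbitZ x) (orbitZ y) ↔ ∃ n, RightAsymptotic x (shiftZIter n y) := by
  constructor
  · rintro ⟨_, ⟨m, rfl⟩, _, ⟨n, rfl⟩, h⟩
    refine ⟨-m + n, ?_⟩
    simpa [shiftZIter_shiftZIter, shiftZIter_zero] using h.shiftZIter (-m)
  · rintro ⟨n, h⟩
    exact ⟨x, mem_orbitZ_self x, _, shiftZIter_mem_orbitZ n y, h⟩

theorem simRA_orbitZ_iff {x y : ℤ → A} :
    SimRA (orbitZ x) (orbitZ y) ↔ ∃ n, RightAsymptotic x (shiftZIter n y) := by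
  constructor
  · rintro (h | h)
    · obtain ⟨n, hn⟩ : x ∈ orbitZ y := h ▸ mem_orbitZ_self x
      exact ⟨n, ⟨0, fun m _ => (congrFun hn m).symm⟩⟩
    · exact orbitsContainRA_orbitZ_iff.1 h
  · exact fun h => Or.inr (orbitsContainRA_orbitZ_iff.2 h)

theorem isRAOrbit_orbitZ_iff {X : Set (ℤ → A)} (hX : ∀ n, ∀ x ∈ X, shiftZIter n x ∈ X)
    {x : ℤ → A} (hx : x ∈ X) :
    IsRAOrbit X (orbitZ x) ↔ ∃ y ∈ X, orbitZ x ≠ orbitZ y ∧ RightAsymptotic x y := by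
  constructor
  · rintro ⟨-, y, hy, hd, hr⟩
    obtain ⟨n, hn⟩ := orbitsContainRA_orbitZ_iff.1 hr
    refine ⟨_, hX n y hy, ?_, hn⟩
    rw [orbitZ_shiftZIter]
    exact (orbitZ_inter_eq_empty_iff x y).1 hd
  · rintro ⟨y, hy, hd, hr⟩
    exact ⟨⟨x, hx, rfl⟩, y, hy, (orbitZ_inter_eq_empty_iff x y).2 hd,
      x, mem_orbitZ_self x, y, mem_orbitZ_self y, hr⟩

theorem shiftZIter_mem {X : Set (ℤ → A)} (hinv : shiftZ '' X = X) (n : ℤ) (x : ℤ → A)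
    (hx : x ∈ X) : shiftZIter n x ∈ X := by
  induction n using Int.induction_on with
  | zero => rwa [shiftZIter_zero]
  | succ n ih =>
    rw [add_comm, ← shiftZIter_shiftZIter]
    exact hinv ▸ Set.mem_image_of_mem shiftZ ih
  | pred n ih =>
    obtain ⟨y, hy, hxy⟩ := hinv.symm ▸ ih
    convert hy using 1
    have : shiftZIter 1 y = shiftZIter (-n) x := hxy
    rw [sub_eq_neg_add, ← shiftZIter_shiftZIter, ← this, shiftZIter_shiftZIter]
    exact shiftZIter_zero y

/-- Two sequences which differ to the left of `N` have a last difference to the left of `N`. -/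
theorem exists_last_ne {x y : ℤ → A} {N : ℤ} (h : ∃ j < N, x j ≠ y j) :
    ∃ j < N, x j ≠ y j ∧ ∀ i, j < i → i < N → x i = y i := by
  obtain ⟨j, ⟨hj, hne⟩, hmax⟩ := Int.exists_greatest_of_bdd (P := fun j => j < N ∧ x j ≠ y j)
    ⟨N, fun _ hz => hz.1.le⟩ h
  refine ⟨j, hj, hne, fun i hi hiN => ?_⟩
  by_contra hxy
  exact absurd (hmax i ⟨hiN, hxy⟩) (by omega)

theorem RightAsymptotic.exists_last_ne {x y : ℤ → A} (h : RightAsymptotic x y) (hne : x ≠ y) :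
    ∃ j, x j ≠ y j ∧ ∀ i, j < i → x i = y i := by
  obtain ⟨N, hN⟩ := h
  obtain ⟨j, hj⟩ := Function.ne_iff.1 hne
  have hjN : j < N := by
    by_contra hlt
    exact hj (hN j (by omega))
  obtain ⟨l, -, hl, hlast⟩ := _root_.exists_last_ne ⟨j, hjN, hj⟩
  exact ⟨l, hl, fun i hi => (lt_or_ge i N).elim (hlast i hi) (hN i)⟩

/-- The right-infinite words of `X` admitting two distinct extensions by one letter to the left. -/
def leftSpecialRays (X : Set (ℤ → A)) : Set (ℕ → A) :=
  {w | ∃ x ∈ X, ∃ y ∈ X, x (-1) ≠ y (-1) ∧ ∀ n : ℕ, x n = w n ∧ y n = w n}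

/-- The right half of a bi-infinite sequence. -/
def rightRay (x : ℤ → A) : ℕ → A := fun n => x n

theorem rightRay_mem_leftSpecialRays {X : Set (ℤ → A)}
    (hX : ∀ n, ∀ x ∈ X, shiftZIter n x ∈ X) {x y : ℤ → A} (hx : x ∈ X) (hy : y ∈ X) {j : ℤ}
    (hne : x j ≠ y j) (h : ∀ i, j < i → x i = y i) :
    rightRay (shiftZIter (j + 1) x) ∈ leftSpecialRays X := by
  refine ⟨_, hX (j + 1) x hx, _, hX (j + 1) y hy, ?_, fun n => ⟨rfl, ?_⟩⟩
  · simpa [shiftZIter_apply] using hne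
  · exact (h _ (by omega)).symm

theorem exists_ne_agree_on_prefix [Finite A] {X : Set (ℤ → A)}
    (hX : ∀ n, ∀ x ∈ X, shiftZIter n x ∈ X) (hinf : X.Infinite) (n : ℕ) :
    ∃ x ∈ X, ∃ y ∈ X, x (-1) ≠ y (-1) ∧ ∀ j : ℕ, j < n → x j = y j := by
  obtain ⟨F, hF, hcard⟩ := hinf.exists_subset_card_eq (Nat.card (Fin n → A) + 1)
  have hev : ∀ᶠ M : ℤ in atTop, ∀ x ∈ F, ∀ y ∈ F, x ≠ y → ∃ j < M, x j ≠ y j := by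
    simp only [eventually_all_finset]
    intro x _ y _
    by_cases h : x = y
    · simp [h]
    · obtain ⟨j, hj⟩ := Function.ne_iff.1 h
      filter_upwards [eventually_gt_atTop j] with M hM _
      exact ⟨j, hM, hj⟩
  obtain ⟨M, hM⟩ := hev.exists
  have := Fintype.ofFinite (Fin n → A)
  obtain ⟨x, hx, y, hy, hne, hxy⟩ := Finset.exists_ne_map_eq_of_card_lt_of_maps_to
    (s := F) (t := Finset.univ) (f := fun x (j : Fin n) => x (M - n + (j : ℕ)))
    (by rw [hcard, Finset.card_univ, Nat.card_eq_fintype_card]; omega) (fun _ _ => by simp)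
  obtain ⟨j, hjM, hj, hlast⟩ := exists_last_ne (hM x hx y hy hne)
  have hjn : j < M - n := by
    by_contra hge
    have := congrFun hxy ⟨(j - (M - n)).toNat, by omega⟩
    simp only [Int.toNat_of_nonneg (show 0 ≤ j - (M - n) by omega), add_sub_cancel] at this
    exact hj this
  refine ⟨_, hX (j + 1) x (hF hx), _, hX (j + 1) y (hF hy), ?_, fun i hi => ?_⟩
  · simpa [shiftZIter_apply] using hj
  · exact hlast _ (by omega) (by omega)

end Shift

section Counting

variable {A : Type*} [Fintype A]

theorem complexityZ_add_card_le {X : Set (ℤ → A)} {n : ℕ} {F : Finset (ℕ → A)}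
    (hF : ↑F ⊆ leftSpecialRays X)
    (hinj : ∀ w ∈ F, ∀ w' ∈ F, (∀ j < n, w j = w' j) → w = w') :
    complexityZ X n + F.card ≤ complexityZ X (n + 1) := by
  let L : (m : ℕ) → Set (Fin m → A) := fun m =>
    {w | ∃ x ∈ X, ∃ i : ℤ, ∀ j : Fin m, w j = x (i + (j : ℕ))}
  have hg : ∀ w : L n, ∃ v : L (n + 1), Fin.tail v.1 = w.1 := by
    rintro ⟨w, x, hx, i, hw⟩
    refine ⟨⟨fun j => x (i - 1 + (j : ℕ)), x, hx, i - 1, fun _ => rfl⟩, ?_⟩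
    funext j
    simp only [Fin.tail, hw, Fin.val_succ]
    congr 1
    push_cast
    ring
  choose g hg using hg
  have hf : ∀ w : F, ∃ v : L (n + 1), (∀ j : Fin n, Fin.tail v.1 j = w.1 j) ∧
      ∀ u, v ≠ g u := by
    rintro ⟨w, hw⟩
    obtain ⟨x, hx, y, hy, hne, hxy⟩ := hF hw
    have key : ∀ z ∈ X, (∀ m : ℕ, z m = w m) →
        ∃ v : L (n + 1), (∀ j : Fin n, Fin.tail v.1 j = w j) ∧ v.1 0 = z (-1) := by
      intro z hz hzw
      refine ⟨⟨fun j => z (-1 + (j : ℕ)), z, hz, -1, fun _ => rfl⟩, fun j => ?_, by simp⟩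
      rw [← hzw]
      simp [Fin.tail]
    obtain ⟨vx, hvx, hvx0⟩ := key x hx fun m => (hxy m).1
    obtain ⟨vy, hvy, hvy0⟩ := key y hy fun m => (hxy m).2
    by_cases h : ∃ u, vx = g u
    · obtain ⟨u, rfl⟩ := h
      refine ⟨vy, hvy, ?_⟩
      rintro u' rfl
      have : u = u' := by
        apply Subtype.ext
        funext j
        rw [← hg u, ← hg u', hvx, hvy]
      subst this
      exact hne (hvx0.symm.trans hvy0)
    · exact ⟨vx, hvx, not_exists.1 h⟩
  choose f hf hfg using hf
  have : Function.Injective (Sum.elim g f) := by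
    refine Function.Injective.sumElim ?_ ?_ fun u w h => hfg w u h.symm
    · intro u u' h
      apply Subtype.ext
      rw [← hg u, ← hg u', h]
    · intro w w' h
      refine Subtype.ext (hinj _ w.2 _ w'.2 fun j hj => ?_)
      rw [← hf w ⟨j, hj⟩, ← hf w' ⟨j, hj⟩, h]
  calc complexityZ X n + F.card = Nat.card (L n ⊕ F) := by
        rw [Nat.card_sum, Nat.card_eq_finsetCard, complexityZ]
    _ ≤ Nat.card (L (n + 1)) := Nat.card_le_card_of_injective _ this
    _ = complexityZ X (n + 1) := rfl

theorem finite_leftSpecialRays {X : Set (ℤ → A)} (hsub : SublinearComplexityZ X) :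
    (leftSpecialRays X).Finite := by
  by_contra hinf
  obtain ⟨C, hC⟩ := hsub
  obtain ⟨F, hF, hcard⟩ := Set.Infinite.exists_subset_card_eq hinf (C + 1)
  have hev : ∀ᶠ n : ℕ in atTop, ∀ w ∈ F, ∀ w' ∈ F, (∀ j < n, w j = w' j) → w = w' := by
    simp only [eventually_all_finset]
    intro w _ w' _
    by_cases h : w = w'
    · simp [h]
    · obtain ⟨j, hj⟩ := Function.ne_iff.1 h
      filter_upwards [eventually_gt_atTop j] with n hn hall
      exact absurd (hall j hn) hj
  obtain ⟨n, hn⟩ := eventually_atTop.1 hev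
  have hgrow : ∀ m, (C + 1) * m ≤ complexityZ X (n + m) := by
    intro m
    induction m with
    | zero => simp
    | succ m ih =>
      have := complexityZ_add_card_le hF (hn (n + m) (by omega))
      rw [hcard] at this
      rw [← add_assoc, mul_add, mul_one]
      omega
  have h₁ := hgrow (C * n + 1)
  have h₂ := hC (n + (C * n + 1)) (by omega)
  nlinarith

end Counting

section Dynamics

variable {A : Type*} [TopologicalSpace A] [DiscreteTopology A]

theorem setOf_agree_mem_nhds (z : ℤ → A) (k : ℤ) :
    {y : ℤ → A | ∀ i, |i| ≤ k → y i = z i} ∈ 𝓝 z := by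
  have := set_pi_mem_nhds (Set.finite_Icc (-k) k) (s := fun i => {z i}) (x := z)
    fun i _ => (isOpen_discrete _).mem_nhds rfl
  filter_upwards [this] with y hy i hi
  exact hy i (abs_le.1 hi)

theorem exists_forward_visit {X : Set (ℤ → A)} (hcomp : IsCompact X)
    (hX : ∀ n, ∀ x ∈ X, shiftZIter n x ∈ X) (hmin : MinimalZ X) {x z : ℤ → A}
    (hx : x ∈ X) (hz : z ∈ X) (N k : ℤ) :
    ∃ m, N ≤ m ∧ ∀ i, |i| ≤ k → x (i + m) = z i := by
  obtain ⟨y, hy, hcl⟩ := hcomp.exists_mapClusterPt_of_frequently (l := atTop)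
    (f := fun m : ℕ => shiftZIter m x) (Frequently.of_forall fun m => hX m x hx)
  obtain ⟨_, hyt, t, rfl⟩ := mem_closure_iff_nhds.1 (hmin y hy hz) _ (setOf_agree_mem_nhds z k)
  obtain ⟨m, hm, hmN⟩ := ((hcl.frequently (setOf_agree_mem_nhds y (k + |t|))).and_eventually
    (eventually_ge_atTop (N - t).toNat)).exists
  refine ⟨m + t, by omega, fun i hi => ?_⟩
  rw [← hyt i hi]
  have := hm (i + t) ((abs_add_le i t).trans (by omega))
  rw [shiftZIter_apply] at this
  exact (congrArg x (by ring)).trans this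

theorem eq_of_rightRay_shiftZIter_eq [Finite A] {X : Set (ℤ → A)} (hcomp : IsCompact X)
    (hX : ∀ n, ∀ x ∈ X, shiftZIter n x ∈ X) (hmin : MinimalZ X) (hinf : X.Infinite)
    {x : ℤ → A} (hx : x ∈ X) {a b : ℤ}
    (h : rightRay (shiftZIter a x) = rightRay (shiftZIter b x)) : a = b := by
  wlog hab : a ≤ b generalizing a b
  · exact (this h.symm (by omega)).symm
  by_contra hne
  have hper : ∀ z ∈ X, Function.Periodic z (b - a) := by
    intro z hz j
    obtain ⟨m, hm, hxz⟩ := exists_forward_visit hcomp hX hmin hx hz (a - j) (|j| + |b - a|)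
    rw [← hxz j (by simp), ← hxz (j + (b - a)) (abs_add_le _ _)]
    have := congrFun h (j + m - a).toNat
    simp only [rightRay, shiftZIter_apply] at this
    rw [Int.toNat_of_nonneg (by omega)] at this
    convert this.symm using 2 <;> ring
  have hmod : ∀ z ∈ X, ∀ j, z (j % (b - a)) = z j := by
    intro z hz j
    rw [Int.emod_def, mul_comm]
    simpa using (hper z hz).sub_int_mul_eq (j / (b - a))
  refine hinf (Set.Finite.of_finite_image (f := (Set.Ico 0 (b - a)).domRestrict) ?_ ?_)
  · have := (Set.finite_Ico 0 (b - a)).to_subtype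
    exact Set.toFinite _
  · intro z hz z' hz' hzz
    funext j
    rw [← hmod z hz, ← hmod z' hz']
    exact congrFun hzz ⟨j % (b - a), Int.emod_nonneg _ (by omega), Int.emod_lt_of_pos _ (by omega)⟩

theorem exists_asymptotic_pair [Finite A] {X : Set (ℤ → A)} (hcomp : IsCompact X)
    (hX : ∀ n, ∀ x ∈ X, shiftZIter n x ∈ X) (hinf : X.Infinite) :
    ∃ x ∈ X, ∃ y ∈ X, x (-1) ≠ y (-1) ∧ ∀ j : ℕ, x j = y j := by
  have := isCompact_iff_compactSpace.1 hcomp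
  let t : ℕ → Set (X × X) := fun n =>
    {p | p.1.1 (-1) ≠ p.2.1 (-1) ∧ ∀ j : ℕ, j < n → p.1.1 j = p.2.1 j}
  have hc₁ : ∀ i : ℤ, Continuous fun p : X × X => p.1.1 i := fun i =>
    (continuous_apply i).comp (continuous_subtype_val.comp continuous_fst)
  have hc₂ : ∀ i : ℤ, Continuous fun p : X × X => p.2.1 i := fun i =>
    (continuous_apply i).comp (continuous_subtype_val.comp continuous_snd)
  have hclosed : ∀ n, IsClosed (t n) := by
    intro n
    simp only [t, Set.ofPred_and, Set.ofPred_forall]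
    refine IsClosed.inter ?_ (isClosed_iInter fun j => isClosed_iInter fun _ =>
      isClosed_eq (hc₁ j) (hc₂ j))
    exact (isClosed_discrete {q : A × A | q.1 ≠ q.2}).preimage ((hc₁ (-1)).prodMk (hc₂ (-1)))
  obtain ⟨⟨x, y⟩, hxy⟩ := IsCompact.nonempty_iInter_of_sequence_nonempty_isCompact_isClosed t
    (fun n p hp => ⟨hp.1, fun j hj => hp.2 j (by omega)⟩)
    (fun n => by
      obtain ⟨x, hx, y, hy, h⟩ := exists_ne_agree_on_prefix hX hinf n
      exact ⟨(⟨x, hx⟩, ⟨y, hy⟩), h⟩)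
    (hclosed 0).isCompact hclosed
  rw [Set.mem_iInter] at hxy
  exact ⟨x, x.2, y, y.2, (hxy 0).1, fun j => (hxy (j + 1)).2 j (by omega)⟩

theorem finite_setOf_isRAOrbit [Fintype A] {X : Set (ℤ → A)} (hcomp : IsCompact X)
    (hX : ∀ n, ∀ x ∈ X, shiftZIter n x ∈ X) (hmin : MinimalZ X) (hinf : X.Infinite)
    (hsub : SublinearComplexityZ X) : {O | IsRAOrbit X O}.Finite := by
  have hR := finite_leftSpecialRays hsub
  let Y : Set (ℤ → A) := {x | x ∈ X ∧ rightRay x ∈ leftSpecialRays X ∧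
    ∀ n < 0, rightRay (shiftZIter n x) ∉ leftSpecialRays X}
  have hY : Y.Finite := by
    refine Set.Finite.of_injOn (f := fun x : ℤ → A => (x (-1), rightRay x))
      (t := Set.univ ×ˢ leftSpecialRays X) (fun x hx => ⟨trivial, hx.2.1⟩) ?_
      (Set.finite_univ.prod hR)
    intro x hx y hy hxy
    obtain ⟨h₁, h₂⟩ := Prod.mk.inj hxy
    have hagree : ∀ i : ℤ, -1 ≤ i → x i = y i := by
      intro i hi
      rcases hi.eq_or_lt with rfl | hi
      · exact h₁
      · simpa [rightRay, Int.toNat_of_nonneg (show 0 ≤ i by omega)] using congrFun h₂ i.toNat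
    by_contra hne
    obtain ⟨j, hj, hlast⟩ := RightAsymptotic.exists_last_ne ⟨-1, hagree⟩ hne
    refine hx.2.2 (j + 1) ?_ (rightRay_mem_leftSpecialRays hX hx.1 hy.1 hj hlast)
    by_contra hlt
    exact hj (hagree j (by omega))
  refine (hY.image orbitZ).subset ?_
  intro O hO
  obtain ⟨x, hx, rfl⟩ := hO.1
  obtain ⟨y, hy, hd, hr⟩ := (isRAOrbit_orbitZ_iff hX hx).1 hO
  obtain ⟨j, hj, hlast⟩ := hr.exists_last_ne fun h => hd (congrArg orbitZ h)
  have hP : {n : ℤ | rightRay (shiftZIter n x) ∈ leftSpecialRays X}.Finite :=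
    hR.preimage fun a _ b _ h => eq_of_rightRay_shiftZIter_eq hcomp hX hmin hinf hx h
  obtain ⟨n, hn, hmin'⟩ := hP.exists_minimalFor id _
    ⟨j + 1, rightRay_mem_leftSpecialRays hX hx hy hj hlast⟩
  refine ⟨shiftZIter n x, ⟨hX n x hx, hn, fun m hm hmem => ?_⟩, orbitZ_shiftZIter n x⟩
  rw [shiftZIter_shiftZIter] at hmem
  have := hmin' hmem (show m + n ≤ n by omega)
  simp only [id] at this
  omega

end Dynamics

section Automorphisms

variable {A : Type*} [TopologicalSpace A] {X : Set (ℤ → A)}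

theorem IsAutZ.symm (hX : ∀ n, ∀ x ∈ X, shiftZIter n x ∈ X) {Φ : X ≃ₜ X} (hΦ : IsAutZ X Φ) :
    IsAutZ X Φ.symm := by
  intro x y hxy
  have h := hΦ (Φ.symm x) ⟨shiftZ (Φ.symm x).1, hX 1 _ (Φ.symm x).2⟩ rfl
  rw [Φ.apply_symm_apply, ← hxy] at h
  rw [← Subtype.ext h, Φ.symm_apply_apply]

theorem IsAutZ.map_shiftZIter (hX : ∀ n, ∀ x ∈ X, shiftZIter n x ∈ X) {Φ : X ≃ₜ X}
    (hΦ : IsAutZ X Φ) (n : ℤ) (x : X) :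
    (Φ ⟨shiftZIter n x, hX n x x.2⟩ : ℤ → A) = shiftZIter n (Φ x) := by
  induction n using Int.induction_on with
  | zero => simp only [shiftZIter_zero]
  | succ n ih =>
    rw [hΦ ⟨shiftZIter n x, hX n x x.2⟩, ih]
    · exact (shiftZIter_shiftZIter 1 n _).trans (by rw [add_comm])
    · exact (congrArg (shiftZIter · x.1) (add_comm _ _)).trans
        (shiftZIter_shiftZIter 1 n x.1).symm
  | pred n ih =>
    have h := hΦ ⟨shiftZIter (-n - 1) x, hX _ x x.2⟩ ⟨shiftZIter (-n) x, hX _ x x.2⟩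
      ((shiftZIter_shiftZIter 1 (-n - 1) x.1).trans (by ring_nf)).symm
    rw [ih] at h
    change _ = shiftZIter 1 _ at h
    rw [sub_eq_neg_add (-(n : ℤ)), ← shiftZIter_shiftZIter _ _ (Φ x).1, h, shiftZIter_shiftZIter]
    simp only [← sub_eq_neg_add, sub_self, shiftZIter_zero]

/-- The map induced by `Φ : X ≃ₜ X` on subsets of `A^ℤ`. -/
def mapOrbit (Φ : X ≃ₜ X) (O : Set (ℤ → A)) : Set (ℤ → A) :=
  Subtype.val '' (Φ '' (Subtype.val ⁻¹' O))

theorem mapOrbit_orbitZ (hX : ∀ n, ∀ x ∈ X, shiftZIter n x ∈ X) {Φ : X ≃ₜ X}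
    (hΦ : IsAutZ X Φ) (x : X) : mapOrbit Φ (orbitZ x) = orbitZ (Φ x : ℤ → A) := by
  ext y
  constructor
  · rintro ⟨_, ⟨z, ⟨n, hn⟩, rfl⟩, rfl⟩
    obtain rfl : ⟨shiftZIter n x, hX n x x.2⟩ = z := Subtype.ext hn
    exact ⟨n, (hΦ.map_shiftZIter hX n x).symm⟩
  · rintro ⟨n, rfl⟩
    exact ⟨_, ⟨_, ⟨n, rfl⟩, rfl⟩, hΦ.map_shiftZIter hX n x⟩

variable [DiscreteTopology A]

/-- Automorphisms are sliding block codes. -/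
theorem IsAutZ.exists_radius (hcomp : IsCompact X) (hX : ∀ n, ∀ x ∈ X, shiftZIter n x ∈ X)
    {Φ : X ≃ₜ X} (hΦ : IsAutZ X Φ) :
    ∃ k : ℤ, ∀ (x y : X) (a b : ℤ), (∀ i, |i| ≤ k → x.1 (i + a) = y.1 (i + b)) →
      (Φ x).1 a = (Φ y).1 b := by
  have := isCompact_iff_compactSpace.1 hcomp
  let t : ℕ → Set (X × X) := fun n =>
    {p | (Φ p.1).1 0 ≠ (Φ p.2).1 0 ∧ ∀ i : ℤ, |i| ≤ n → p.1.1 i = p.2.1 i}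
  have hc₁ : ∀ i : ℤ, Continuous fun p : X × X => p.1.1 i := fun i =>
    (continuous_apply i).comp (continuous_subtype_val.comp continuous_fst)
  have hc₂ : ∀ i : ℤ, Continuous fun p : X × X => p.2.1 i := fun i =>
    (continuous_apply i).comp (continuous_subtype_val.comp continuous_snd)
  have hclosed : ∀ n, IsClosed (t n) := by
    intro n
    simp only [t, Set.ofPred_and, Set.ofPred_forall]
    refine IsClosed.inter ?_ (isClosed_iInter fun j => isClosed_iInter fun _ =>
      isClosed_eq (hc₁ j) (hc₂ j))
    exact (isClosed_discrete {q : A × A | q.1 ≠ q.2}).preimage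
      (((hc₁ 0).comp (Φ.continuous.prodMap Φ.continuous)).prodMk
        ((hc₂ 0).comp (Φ.continuous.prodMap Φ.continuous)))
  obtain ⟨k, hk⟩ : ∃ k, ¬ (t k).Nonempty := by
    by_contra! hne
    obtain ⟨⟨x, y⟩, hxy⟩ := IsCompact.nonempty_iInter_of_sequence_nonempty_isCompact_isClosed t
      (fun n p hp => ⟨hp.1, fun i hi => hp.2 i (by omega)⟩) hne (hclosed 0).isCompact hclosed
    rw [Set.mem_iInter] at hxy
    have heq : x = y := Subtype.ext (funext fun i => (hxy i.natAbs).2 i (Int.abs_eq_natAbs i).le)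
    exact (hxy 0).1 (by rw [heq])
  refine ⟨k, fun x y a b h => ?_⟩
  by_contra hne
  refine hk ⟨(⟨_, hX a x x.2⟩, ⟨_, hX b y y.2⟩), ?_, h⟩
  simpa [hΦ.map_shiftZIter hX, shiftZIter_apply] using hne

theorem IsAutZ.rightAsymptotic (hcomp : IsCompact X) (hX : ∀ n, ∀ x ∈ X, shiftZIter n x ∈ X)
    {Φ : X ≃ₜ X} (hΦ : IsAutZ X Φ) {x y : X} (h : RightAsymptotic x.1 y.1) :
    RightAsymptotic (Φ x).1 (Φ y).1 := by
  obtain ⟨k, hk⟩ := hΦ.exists_radius hcomp hX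
  obtain ⟨N, hN⟩ := h
  refine ⟨N + k, fun n hn => hk x y n n fun i hi => hN _ ?_⟩
  have := abs_le.1 hi
  omega

theorem IsAutZ.eq_shiftZIter_of_rightAsymptotic (hcomp : IsCompact X)
    (hX : ∀ n, ∀ x ∈ X, shiftZIter n x ∈ X) (hmin : MinimalZ X) {Φ Ψ : X ≃ₜ X}
    (hΦ : IsAutZ X Φ) (hΨ : IsAutZ X Ψ) {x : X} {n : ℤ}
    (h : RightAsymptotic (Φ x).1 (shiftZIter n (Ψ x).1)) (z : X) :
    (Φ z : ℤ → A) = shiftZIter n (Ψ z) := by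
  obtain ⟨k, hk⟩ := hΦ.exists_radius hcomp hX
  obtain ⟨l, hl⟩ := hΨ.exists_radius hcomp hX
  obtain ⟨N, hN⟩ := h
  funext j
  obtain ⟨m, hm, hxz⟩ := exists_forward_visit hcomp hX hmin x.2 z.2 (N - j)
    (max k l + |j| + |j + n|)
  calc (Φ z).1 j = (Φ x).1 (j + m) := hk _ _ _ _ fun i hi => by
        rw [← add_assoc, hxz (i + j) ((abs_add_le i j).trans (by
          have := abs_nonneg (j + n); omega))]
    _ = (Ψ x).1 (j + m + n) := hN _ (by omega)
    _ = (Ψ z).1 (j + n) := hl _ _ _ _ fun i hi => by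
        rw [← hxz (i + (j + n)) ((abs_add_le _ _).trans (by have := abs_nonneg j; omega))]
        exact congrArg x.1 (by ring)

theorem IsAutZ.isRAOrbit (hcomp : IsCompact X) (hX : ∀ n, ∀ x ∈ X, shiftZIter n x ∈ X)
    {Φ : X ≃ₜ X} (hΦ : IsAutZ X Φ) {x : X} (h : IsRAOrbit X (orbitZ x.1)) :
    IsRAOrbit X (orbitZ (Φ x).1) := by
  obtain ⟨y, hy, hne, hr⟩ := (isRAOrbit_orbitZ_iff hX x.2).1 h
  refine (isRAOrbit_orbitZ_iff hX (Φ x).2).2 ⟨Φ ⟨y, hy⟩, (Φ ⟨y, hy⟩).2, fun he => hne ?_,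
    hΦ.rightAsymptotic hcomp hX (y := ⟨y, hy⟩) hr⟩
  have := congrArg (mapOrbit Φ.symm) he
  simpa [mapOrbit_orbitZ hX (hΦ.symm hX)] using this

theorem IsAutZ.mapsTo_simClass (hcomp : IsCompact X)
    (hX : ∀ n, ∀ x ∈ X, shiftZIter n x ∈ X) {Φ : X ≃ₜ X} (hΦ : IsAutZ X Φ) (x : X) :
    Set.MapsTo (mapOrbit Φ) (SimClass X (orbitZ x.1)) (SimClass X (orbitZ (Φ x).1)) := by
  rintro O ⟨hO, hsim⟩
  obtain ⟨y, hy, rfl⟩ := hO.1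
  lift y to X using hy
  obtain ⟨n, hn⟩ := simRA_orbitZ_iff.1 hsim
  rw [mapOrbit_orbitZ hX hΦ]
  refine ⟨hΦ.isRAOrbit hcomp hX hO, simRA_orbitZ_iff.2 ⟨n, ?_⟩⟩
  rw [← hΦ.map_shiftZIter hX]
  exact hΦ.rightAsymptotic hcomp hX hn

theorem IsAutZ.ncard_simClass (hcomp : IsCompact X)
    (hX : ∀ n, ∀ x ∈ X, shiftZIter n x ∈ X) {Φ : X ≃ₜ X} (hΦ : IsAutZ X Φ) (x : X) :
    (SimClass X (orbitZ (Φ x).1)).ncard = (SimClass X (orbitZ x.1)).ncard := by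
  have hinv : ∀ {Ψ : X ≃ₜ X}, IsAutZ X Ψ → ∀ y : X,
      Set.LeftInvOn (mapOrbit Ψ.symm) (mapOrbit Ψ) (SimClass X (orbitZ y.1)) := by
    rintro Ψ hΨ y O ⟨hO, -⟩
    obtain ⟨z, hz, rfl⟩ := hO.1
    lift z to X using hz
    rw [mapOrbit_orbitZ hX hΨ, mapOrbit_orbitZ hX (hΨ.symm hX), Ψ.symm_apply_apply]
  have hmaps := (hΦ.symm hX).mapsTo_simClass hcomp hX (Φ x)
  rw [Φ.symm_apply_apply] at hmaps
  have hbij : Set.BijOn (mapOrbit Φ) (SimClass X (orbitZ x.1)) (SimClass X (orbitZ (Φ x).1)) :=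
    Set.InvOn.bijOn ⟨hinv hΦ x, hinv (hΦ.symm hX) (Φ x)⟩ (hΦ.mapsTo_simClass hcomp hX x) hmaps
  rw [← hbij.image_eq, hbij.injOn.ncard_image]

end Automorphisms

/-- For an infinite minimal two-sided shift with sublinear complexity,
some `k ≥ 2` admits a `∼`-class of right asymptotic orbits of size `k`, and for each such
`k`, the automorphism group modulo the powers of the shift has at most `M̄_k` elements
(i.e., at most `M̄_k` automorphisms suffice to represent all automorphisms up to
composition with a power of the shift); hence at most `M̄ = min M̄_k` elements. -/
theorem aut_mod_shift_card_le_min_RA_classes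
    {A : Type*} [Fintype A] [TopologicalSpace A] [DiscreteTopology A]
    (X : Set (ℤ → A)) (hne : X.Nonempty) (hclosed : IsClosed X)
    (hinv : shiftZ '' X = X)
    (hmin : MinimalZ X) (hinf : X.Infinite)
    (hsub : SublinearComplexityZ X) :
    (∃ k : ℕ, 2 ≤ k ∧ 1 ≤ numRAClassesOfSize X k) ∧
      ∀ k : ℕ, 2 ≤ k → 1 ≤ numRAClassesOfSize X k →
        ∃ S : Set {Φ : X ≃ₜ X // IsAutZ X Φ},
          S.Finite ∧ S.ncard ≤ numRAClassesOfSize X k ∧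
            ∀ Φ : X ≃ₜ X, IsAutZ X Φ → ∃ Ψ ∈ S, ∃ n : ℤ,
              ∀ x : X, (Φ x : ℤ → A) = shiftZIter n ((Ψ : X ≃ₜ X) x : ℤ → A) := by
  have hcomp : IsCompact X := hclosed.isCompact
  have hX := shiftZIter_mem hinv
  constructor
  · obtain ⟨x, hx, y, hy, hne, hxy⟩ := exists_asymptotic_pair hcomp hX hinf
    have hr : RightAsymptotic x y :=
      ⟨0, fun n hn => by simpa [Int.toNat_of_nonneg hn] using hxy n.toNat⟩
    have hd : orbitZ x ≠ orbitZ y := by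
      intro he
      obtain ⟨n, rfl⟩ : y ∈ orbitZ x := he ▸ mem_orbitZ_self y
      have h0 : (0 : ℤ) = n := eq_of_rightRay_shiftZIter_eq hcomp hX hmin hinf hx (by
        rw [shiftZIter_zero]
        exact funext hxy)
      subst h0
      exact hne (congrFun (shiftZIter_zero x).symm _)
    have hOx := (isRAOrbit_orbitZ_iff hX hx).2 ⟨y, hy, hd, hr⟩
    have hOy := (isRAOrbit_orbitZ_iff hX hy).2 ⟨x, hx, hd.symm, hr.symm⟩
    have hfin := finite_setOf_isRAOrbit hcomp hX hmin hinf hsub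
    have hfinC : ∀ O, (SimClass X O).Finite := fun O => hfin.subset fun _ h => h.1
    refine ⟨(SimClass X (orbitZ x)).ncard, ?_, ?_⟩
    · exact (Set.one_lt_ncard (hfinC _)).2 ⟨_, ⟨hOx, Or.inl rfl⟩, _,
        ⟨hOy, Or.inr ⟨x, mem_orbitZ_self x, y, mem_orbitZ_self y, hr⟩⟩, hd⟩
    · have : Finite {C : Set (Set (ℤ → A)) // (∃ O, IsRAOrbit X O ∧ C = SimClass X O) ∧
          C.ncard = (SimClass X (orbitZ x)).ncard} := by
        refine (hfin.powerset.subset ?_ : Set.Finite _).to_subtype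
        rintro _ ⟨⟨O, -, rfl⟩, -⟩ O' h
        exact h.1
      have : Nonempty {C : Set (Set (ℤ → A)) // (∃ O, IsRAOrbit X O ∧ C = SimClass X O) ∧
          C.ncard = (SimClass X (orbitZ x)).ncard} := ⟨⟨_, ⟨_, hOx, rfl⟩, rfl⟩⟩
      exact Nat.card_pos
  · intro k _ hk
    let T := {C : Set (Set (ℤ → A)) // (∃ O, IsRAOrbit X O ∧ C = SimClass X O) ∧ C.ncard = k}
    have hT : Nat.card T ≠ 0 := Nat.pos_iff_ne_zero.1 hk
    have : Finite T := Nat.finite_of_card_ne_zero hT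
    obtain ⟨⟨_, ⟨O, hO, rfl⟩, hcard⟩⟩ := (Nat.card_ne_zero.1 hT).1
    obtain ⟨x, hx, rfl⟩ := hO.1
    lift x to X using hx
    let c : {Φ : X ≃ₜ X // IsAutZ X Φ} → T := fun Φ =>
      ⟨SimClass X (orbitZ (Φ.1 x).1), ⟨_, Φ.2.isRAOrbit hcomp hX hO, rfl⟩,
        (Φ.2.ncard_simClass hcomp hX x).trans hcard⟩
    let s := Set.rangeSplitting c
    refine ⟨Set.range s, Set.finite_range s, ?_, fun Φ hΦ => ?_⟩
    · calc (Set.range s).ncard = Nat.card (Set.range s) := rfl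
        _ ≤ Nat.card (Set.range c) := Finite.card_range_le s
        _ ≤ Nat.card T := Finite.card_subtype_le _
    · have hc : c (s ⟨c ⟨Φ, hΦ⟩, Set.mem_range_self _⟩) = c ⟨Φ, hΦ⟩ :=
        Set.apply_rangeSplitting c _
      refine ⟨_, Set.mem_range_self ⟨c ⟨Φ, hΦ⟩, Set.mem_range_self _⟩, ?_⟩
      set Ψ := s ⟨c ⟨Φ, hΦ⟩, Set.mem_range_self _⟩
      have hmem : orbitZ (Ψ.1 x).1 ∈ SimClass X (orbitZ (Φ x).1) := by
        have hc' : SimClass X (orbitZ (Ψ.1 x).1) = SimClass X (orbitZ (Φ x).1) :=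
          congrArg Subtype.val hc
        rw [← hc']
        exact ⟨Ψ.2.isRAOrbit hcomp hX hO, Or.inl rfl⟩
      obtain ⟨n, hn⟩ := simRA_orbitZ_iff.1 hmem.2
      exact ⟨n, hΦ.eq_shiftZIter_of_rightAsymptotic hcomp hX hmin Ψ.2 hn⟩
end

section
/- Let (X̄,σ̄) be an infinite minimal two-sided shift with sublinear complexity, and let M̄ be the minimum, over those k ≥ 2 for which there is at least one ∼-equivalence class of right asymptotic orbits of size k, of the number of such classes of size k. Then every automorphism Φ of (X̄,σ̄) satisfies Φ^m = σ̄^n for some integer m with 1 ≤ m ≤ M̄ and some n ∈ ℤ. -/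
namespace TwoSidedShift

variable {A : Type*}

@[simp]
theorem shiftZIter_apply (n m : ℤ) (x : ℤ → A) : shiftZIter n x m = x (m + n) := rfl

@[simp]
theorem shiftZIter_zero (x : ℤ → A) : shiftZIter 0 x = x := by
  funext m; simp

theorem shiftZIter_shiftZIter (a b : ℤ) (x : ℤ → A) :
    shiftZIter a (shiftZIter b x) = shiftZIter (a + b) x := by
  funext m; simp [add_assoc]

theorem shiftZIter_neg_cancel (a : ℤ) (x : ℤ → A) :
    shiftZIter (-a) (shiftZIter a x) = x := by
  simp [shiftZIter_shiftZIter]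

theorem shiftZ_eq_shiftZIter_one (x : ℤ → A) : shiftZ x = shiftZIter 1 x := rfl

theorem mem_orbitZ_self (x : ℤ → A) : x ∈ orbitZ x := ⟨0, shiftZIter_zero x⟩

theorem shiftZIter_mem_orbitZ (n : ℤ) (x : ℤ → A) : shiftZIter n x ∈ orbitZ x := ⟨n, rfl⟩

theorem orbitZ_shiftZIter (n : ℤ) (x : ℤ → A) : orbitZ (shiftZIter n x) = orbitZ x := by
  ext y
  constructor
  · rintro ⟨m, rfl⟩
    exact ⟨m + n, (shiftZIter_shiftZIter m n x).symm⟩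
  · rintro ⟨m, rfl⟩
    refine ⟨m - n, ?_⟩
    simp [shiftZIter_shiftZIter]

theorem orbitZ_eq_of_mem {x y : ℤ → A} (h : y ∈ orbitZ x) : orbitZ y = orbitZ x := by
  obtain ⟨n, rfl⟩ := h
  exact orbitZ_shiftZIter n x

theorem RightAsymptotic.symm {x y : ℤ → A} (h : RightAsymptotic x y) : RightAsymptotic y x := by
  obtain ⟨N, h⟩ := h
  exact ⟨N, fun n hn => (h n hn).symm⟩

theorem RightAsymptotic.trans {x y z : ℤ → A} (h : RightAsymptotic x y)
    (h' : RightAsymptotic y z) : RightAsymptotic x z := by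
  obtain ⟨N, h⟩ := h
  obtain ⟨M, h'⟩ := h'
  exact ⟨max N M, fun n hn =>
    (h n (le_trans (le_max_left _ _) hn)).trans (h' n (le_trans (le_max_right _ _) hn))⟩

theorem RightAsymptotic.shift {x y : ℤ → A} (h : RightAsymptotic x y) (m : ℤ) :
    RightAsymptotic (shiftZIter m x) (shiftZIter m y) := by
  obtain ⟨N, h⟩ := h
  exact ⟨N - m, fun n hn => h (n + m) (by omega)⟩

theorem simRA_refl (O : Set (ℤ → A)) : SimRA O O := Or.inl rfl

/-- Related orbits contain right asymptotic points, one of which may be prescribed. -/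
theorem exists_rightAsymptotic_shift_of_simRA {x y : ℤ → A}
    (h : SimRA (orbitZ x) (orbitZ y)) : ∃ n, RightAsymptotic x (shiftZIter n y) := by
  rcases h with h | ⟨_, ⟨a, rfl⟩, _, ⟨b, rfl⟩, hab⟩
  · have hx := mem_orbitZ_self x
    rw [h] at hx
    obtain ⟨n, rfl⟩ := hx
    exact ⟨n, 0, fun _ _ => rfl⟩
  · refine ⟨-a + b, ?_⟩
    have := RightAsymptotic.shift hab (-a)
    rwa [shiftZIter_neg_cancel, shiftZIter_shiftZIter] at this

theorem shiftZIter_mem {X : Set (ℤ → A)} (hinv : shiftZ '' X = X) (n : ℤ) {x : ℤ → A}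
    (hx : x ∈ X) : shiftZIter n x ∈ X := by
  induction n using Int.induction_on with
  | zero => simpa using hx
  | succ n ih =>
    rw [add_comm, ← shiftZIter_shiftZIter, ← shiftZ_eq_shiftZIter_one, ← hinv]
    exact Set.mem_image_of_mem _ ih
  | pred n ih =>
    rw [← hinv] at ih
    obtain ⟨y, hy, hyx⟩ := ih
    rw [shiftZ_eq_shiftZIter_one] at hyx
    have : shiftZIter (-(n : ℤ) - 1) x = y := by
      rw [sub_eq_neg_add, ← shiftZIter_shiftZIter, ← hyx, shiftZIter_neg_cancel]
    rwa [this]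

theorem orbitZ_subset {X : Set (ℤ → A)} (hinv : shiftZ '' X = X) {x : ℤ → A}
    (hx : x ∈ X) : orbitZ x ⊆ X := by
  rintro _ ⟨n, rfl⟩
  exact shiftZIter_mem hinv n hx

theorem IsRAOrbit.subset (hinv : shiftZ '' X = X) {O : Set (ℤ → A)} (h : IsRAOrbit X O) :
    O ⊆ X := by
  obtain ⟨⟨x, hx, rfl⟩, -⟩ := h
  exact orbitZ_subset hinv hx

/-- A map of `X` to itself commuting with all powers of the shift. -/
def ShiftEquivariant {X : Set (ℤ → A)} (f : X → X) : Prop :=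
  ∀ (n : ℤ) (x y : X), (y : ℤ → A) = shiftZIter n x → (f y : ℤ → A) = shiftZIter n (f x)

theorem ShiftEquivariant.iterate {X : Set (ℤ → A)} {f : X → X} (hf : ShiftEquivariant f)
    (m : ℕ) : ShiftEquivariant f^[m] := by
  induction m with
  | zero => exact fun n x y h => h
  | succ m ih =>
    intro n x y h
    rw [Function.iterate_succ_apply', Function.iterate_succ_apply']
    exact hf n _ _ (ih n x y h)

/-- A sequence in a compact space has a cluster point, lying in every closed set that
eventually contains the sequence. -/
theorem exists_limit_of_compact {Y : Type*} [TopologicalSpace Y] [CompactSpace Y] (u : ℕ → Y) :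
    ∃ y, ∀ C : Set Y, IsClosed C → (∀ᶠ n in Filter.atTop, u n ∈ C) → y ∈ C := by
  obtain ⟨y, hy⟩ := exists_clusterPt_of_compactSpace (Filter.map u Filter.atTop)
  refine ⟨y, fun C hC h => ?_⟩
  exact hC.closure_eq ▸ (hy.mono (Filter.le_principal_iff.2 h)).mem_closure

section Topology

variable [TopologicalSpace A]

theorem continuous_shiftZIter (n : ℤ) : Continuous (shiftZIter n : (ℤ → A) → ℤ → A) :=
  continuous_pi fun m => continuous_apply (m + n)

theorem IsAutZ.shiftEquivariant {X : Set (ℤ → A)} (hinv : shiftZ '' X = X) {Φ : X ≃ₜ X}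
    (hΦ : IsAutZ X Φ) : ShiftEquivariant Φ := by
  intro n x
  induction n using Int.induction_on with
  | zero =>
    intro y h
    rw [shiftZIter_zero] at h ⊢
    rw [Subtype.ext h]
  | succ n ih =>
    intro y h
    let z : X := ⟨shiftZIter n x, shiftZIter_mem hinv _ x.2⟩
    have hy : (y : ℤ → A) = shiftZ z := by
      rw [h, shiftZ_eq_shiftZIter_one, shiftZIter_shiftZIter, add_comm]
    rw [hΦ z y hy, ih z rfl, shiftZ_eq_shiftZIter_one, shiftZIter_shiftZIter, add_comm]
  | pred n ih =>
    intro y h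
    let z : X := ⟨shiftZIter (-n) x, shiftZIter_mem hinv _ x.2⟩
    have hy : (z : ℤ → A) = shiftZ y := by
      rw [h, shiftZ_eq_shiftZIter_one, shiftZIter_shiftZIter]
      simp [z]
    have h1 := hΦ y z hy
    rw [ih z rfl, shiftZ_eq_shiftZIter_one] at h1
    rw [sub_eq_neg_add, ← shiftZIter_shiftZIter, h1, shiftZIter_neg_cancel]

theorem IsAutZ.symm {X : Set (ℤ → A)} {Φ : X ≃ₜ X} (hinv : shiftZ '' X = X)
    (hΦ : IsAutZ X Φ) : IsAutZ X Φ.symm := by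
  intro x y h
  let z : X := ⟨shiftZIter 1 (Φ.symm x), shiftZIter_mem hinv _ (Φ.symm x).2⟩
  have h1 := hΦ (Φ.symm x) z rfl
  rw [Φ.apply_symm_apply, ← h] at h1
  have h2 : z = Φ.symm y := by rw [← Subtype.ext h1, Φ.symm_apply_apply]
  rw [← h2]
  rfl

variable [DiscreteTopology A]

theorem isClosed_apply_eq {Y : Type*} [TopologicalSpace Y] {f g : Y → ℤ → A}
    (hf : Continuous f) (hg : Continuous g) (i j : ℤ) : IsClosed {y | f y i = g y j} :=
  isClosed_eq ((continuous_apply i).comp hf) ((continuous_apply j).comp hg)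

theorem isClosed_apply_ne {Y : Type*} [TopologicalSpace Y] {f g : Y → ℤ → A}
    (hf : Continuous f) (hg : Continuous g) (i j : ℤ) : IsClosed {y | f y i ≠ g y j} := by
  have : Continuous fun y => (f y i, g y j) :=
    ((continuous_apply i).comp hf).prodMk ((continuous_apply j).comp hg)
  exact (isClosed_discrete {p : A × A | p.1 ≠ p.2}).preimage this

variable [Finite A] {X : Set (ℤ → A)}

/-- Every point of an infinite minimal shift fails to be eventually periodic to the right. -/
theorem not_eventually_periodic (hclosed : IsClosed X) (hinv : shiftZ '' X = X)
    (hmin : MinimalZ X) (hinf : X.Infinite) {x : ℤ → A} (hx : x ∈ X) {d : ℤ} (hd : d ≠ 0) :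
    ¬ RightAsymptotic x (shiftZIter d x) := by
  rintro ⟨N, hN⟩
  have : CompactSpace X := isCompact_iff_compactSpace.1 hclosed.isCompact
  obtain ⟨y, hy⟩ := exists_limit_of_compact
    (fun n : ℕ => (⟨shiftZIter n x, shiftZIter_mem hinv _ hx⟩ : X))
  have hper : ∀ t, (y : ℤ → A) t = (y : ℤ → A) (t + d) := by
    intro t
    refine hy {z | (z : ℤ → A) t = (z : ℤ → A) (t + d)}
      (isClosed_apply_eq continuous_subtype_val continuous_subtype_val _ _) ?_
    filter_upwards [Filter.eventually_ge_atTop (N - t).toNat] with n hn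
    have := hN (t + n) (by omega)
    simp only [shiftZIter_apply] at this
    change x (t + n) = x (t + d + n)
    rw [this]
    congr 1
    ring
  have hshift : shiftZIter d (y : ℤ → A) = y := funext fun t => (hper t).symm
  have hmul : ∀ k : ℤ, shiftZIter (d * k) (y : ℤ → A) = y := by
    intro k
    induction k using Int.induction_on with
    | zero => simp
    | succ k ih => rw [mul_add, mul_one, ← shiftZIter_shiftZIter, hshift, ih]
    | pred k ih =>
      rw [mul_sub, mul_one, sub_eq_add_neg, ← shiftZIter_shiftZIter]
      nth_rw 1 [← hshift]
      rw [shiftZIter_neg_cancel, ih]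
  have hfin : (orbitZ (y : ℤ → A)).Finite := by
    refine ((Set.finite_Ico (0 : ℤ) |d|).image fun n => shiftZIter n (y : ℤ → A)).subset ?_
    rintro _ ⟨n, rfl⟩
    refine ⟨n % d, ⟨Int.emod_nonneg _ hd, Int.emod_lt_abs _ hd⟩, ?_⟩
    change shiftZIter (n % d) (y : ℤ → A) = shiftZIter n (y : ℤ → A)
    conv_rhs => rw [← Int.emod_add_mul_ediv n d, ← shiftZIter_shiftZIter, hmul]
  exact hinf (hfin.subset (hfin.isClosed.closure_eq ▸ hmin y y.2))

/-- An infinite closed shift contains two points whose last disagreement is at `-1`. -/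
theorem exists_left_branching (hclosed : IsClosed X) (hinv : shiftZ '' X = X)
    (hinf : X.Infinite) :
    ∃ x ∈ X, ∃ y ∈ X, x (-1) ≠ y (-1) ∧ ∀ n : ℤ, 0 ≤ n → x n = y n := by
  have : CompactSpace X := isCompact_iff_compactSpace.1 hclosed.isCompact
  by_cases H : ∀ N : ℕ, ∃ p : X × X, (p.1 : ℤ → A) (-1) ≠ (p.2 : ℤ → A) (-1) ∧
      ∀ n : ℤ, 0 ≤ n → n < N → (p.1 : ℤ → A) n = (p.2 : ℤ → A) n
  · choose u hu hu' using H
    obtain ⟨p, hp⟩ := exists_limit_of_compact u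
    refine ⟨p.1, p.1.2, p.2, p.2.2, ?_, fun n hn => ?_⟩
    · exact hp {p | (p.1 : ℤ → A) (-1) ≠ (p.2 : ℤ → A) (-1)}
        (isClosed_apply_ne (continuous_subtype_val.comp continuous_fst)
          (continuous_subtype_val.comp continuous_snd) _ _) (Filter.Eventually.of_forall hu)
    · refine hp {p | (p.1 : ℤ → A) n = (p.2 : ℤ → A) n}
        (isClosed_apply_eq (continuous_subtype_val.comp continuous_fst)
          (continuous_subtype_val.comp continuous_snd) _ _) ?_
      filter_upwards [Filter.eventually_gt_atTop n.toNat] with N hN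
      exact hu' N n hn (by omega)
  · push Not at H
    obtain ⟨N, hN⟩ := H
    have key : ∀ x ∈ X, ∀ y ∈ X, ∀ k : ℤ, (∀ n : ℤ, 0 ≤ n → n < N → x (n + k) = y (n + k)) →
        ∀ j : ℕ, ∀ n : ℤ, -j ≤ n → n < N → x (n + k) = y (n + k) := by
      intro x hx y hy k h j
      induction j with
      | zero => exact fun n hn => h n (by simpa using hn)
      | succ j ih =>
        intro n hn hn'
        rcases eq_or_lt_of_le hn with rfl | hlt
        · by_contra hne
          obtain ⟨n, h0, h1, h2⟩ := hN (⟨shiftZIter (k - j) x, shiftZIter_mem hinv _ hx⟩,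
            ⟨shiftZIter (k - j) y, shiftZIter_mem hinv _ hy⟩) (by
              have e : -((j + 1 : ℕ) : ℤ) + k = -1 + (k - j) := by push_cast; ring
              rw [e] at hne
              exact hne)
          have e : n + (k - j) = (n - j) + k := by ring
          simp only [shiftZIter_apply, e] at h2
          exact h2 (ih _ (by omega) (by omega))
        · exact ih n (by push_cast at hlt; omega) hn'
    have : Infinite X := hinf.to_subtype
    obtain ⟨S, hS⟩ := Infinite.exists_subset_card_eq X (Nat.card (Fin N → A) + 1)
    have hpig : ∀ k : ℕ, ∃ p : S × S, p.1 ≠ p.2 ∧ ∀ i : Fin N,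
        (p.1 : ℤ → A) ((i : ℕ) + k) = (p.2 : ℤ → A) ((i : ℕ) + k) := by
      intro k
      have : ¬ Function.Injective
          (fun (x : S) (i : Fin N) => (x : ℤ → A) ((i : ℕ) + k)) := by
        intro hi
        have := Nat.card_le_card_of_injective _ hi
        rw [Nat.card_eq_fintype_card, Fintype.card_coe, hS] at this
        omega
      rw [Function.not_injective_iff] at this
      obtain ⟨a, b, hab, hne⟩ := this
      exact ⟨(a, b), hne, fun i => congrFun hab i⟩
    choose p hp hp' using hpig
    obtain ⟨q, hq⟩ := Finite.exists_infinite_fiber p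
    rw [Set.infinite_coe_iff] at hq
    obtain ⟨k₀, hk₀ : p k₀ = q⟩ := hq.nonempty
    refine absurd (Subtype.ext (Subtype.ext (funext fun t => ?_))) (hk₀ ▸ hp k₀)
    obtain ⟨k, hk, hkt⟩ := hq.exists_gt t.toNat
    have hkq : p k = q := hk
    have h1 := key _ q.1.1.2 _ q.2.1.2 k (fun n h0 h1 => by
      have := hp' k ⟨n.toNat, by omega⟩
      rw [hkq] at this
      simpa [Int.toNat_of_nonneg h0] using this)
    simpa using h1 (k - t).toNat (t - k) (by omega) (by omega)

theorem exists_disjoint_rightAsymptotic (hclosed : IsClosed X) (hinv : shiftZ '' X = X)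
    (hmin : MinimalZ X) (hinf : X.Infinite) :
    ∃ x ∈ X, ∃ y ∈ X, orbitZ x ∩ orbitZ y = ∅ ∧ RightAsymptotic x y := by
  obtain ⟨x, hx, y, hy, hne, h⟩ := exists_left_branching hclosed hinv hinf
  refine ⟨x, hx, y, hy, ?_, 0, h⟩
  by_contra hcap
  obtain ⟨z, hzx, hzy⟩ := Set.nonempty_iff_ne_empty.2 hcap
  have hyx : y ∈ orbitZ x := by
    rw [← orbitZ_eq_of_mem hzx, orbitZ_eq_of_mem hzy]
    exact mem_orbitZ_self y
  obtain ⟨d, rfl⟩ := hyx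
  refine not_eventually_periodic hclosed hinv hmin hinf hx (d := d) ?_ ⟨0, h⟩
  rintro rfl
  simp at hne

/-- A continuous shift-equivariant self-map preserves right asymptoticity. -/
theorem ShiftEquivariant.rightAsymptotic (hclosed : IsClosed X) (hinv : shiftZ '' X = X)
    {f : X → X} (hf : ShiftEquivariant f) (hc : Continuous f) {x y : X}
    (h : RightAsymptotic (x : ℤ → A) y) : RightAsymptotic (f x : ℤ → A) (f y) := by
  have : CompactSpace X := isCompact_iff_compactSpace.1 hclosed.isCompact
  have hrule : ∃ r : ℕ, ∀ p : X × X,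
      (∀ n : ℤ, -r ≤ n → n ≤ r → (p.1 : ℤ → A) n = (p.2 : ℤ → A) n) →
        (f p.1 : ℤ → A) 0 = (f p.2 : ℤ → A) 0 := by
    by_contra H
    push Not at H
    choose u hu hu' using H
    obtain ⟨p, hp⟩ := exists_limit_of_compact u
    refine hp {p | (f p.1 : ℤ → A) 0 ≠ (f p.2 : ℤ → A) 0}
      (isClosed_apply_ne (continuous_subtype_val.comp (hc.comp continuous_fst))
        (continuous_subtype_val.comp (hc.comp continuous_snd)) _ _)
      (Filter.Eventually.of_forall hu') ?_
    have : p.1 = p.2 := by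
      apply Subtype.ext
      funext n
      refine hp {p | (p.1 : ℤ → A) n = (p.2 : ℤ → A) n}
        (isClosed_apply_eq (continuous_subtype_val.comp continuous_fst)
          (continuous_subtype_val.comp continuous_snd) _ _) ?_
      filter_upwards [Filter.eventually_ge_atTop n.natAbs] with N hN
      exact hu N n (by omega) (by omega)
    rw [this]
  obtain ⟨r, hr⟩ := hrule
  obtain ⟨N, hN⟩ := h
  refine ⟨N + r, fun n hn => ?_⟩
  let x' : X := ⟨shiftZIter n x, shiftZIter_mem hinv _ x.2⟩
  let y' : X := ⟨shiftZIter n y, shiftZIter_mem hinv _ y.2⟩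
  have := hr (x', y') fun m hm _ => hN (m + n) (by omega)
  rw [hf n x x' rfl, hf n y y' rfl] at this
  simpa using this

/-- If a continuous equivariant self-map of a minimal shift sends one point to a point
right asymptotic to its `n`-th shift, then it is the `n`-th power of the shift. -/
theorem ShiftEquivariant.eq_shiftZIter (hclosed : IsClosed X) (hinv : shiftZ '' X = X)
    (hmin : MinimalZ X) {f : X → X} (hf : ShiftEquivariant f) (hc : Continuous f) {x : X}
    {n : ℤ} (h : RightAsymptotic (f x : ℤ → A) (shiftZIter n x)) (z : X) :
    (f z : ℤ → A) = shiftZIter n z := by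
  have : CompactSpace X := isCompact_iff_compactSpace.1 hclosed.isCompact
  obtain ⟨N, hN⟩ := h
  let u : ℤ → X := fun j => ⟨shiftZIter j x, shiftZIter_mem hinv _ x.2⟩
  obtain ⟨y, hy⟩ := exists_limit_of_compact fun j : ℕ => u j
  have hfc : Continuous fun z : X => (f z : ℤ → A) := continuous_subtype_val.comp hc
  have hsc : Continuous fun z : X => shiftZIter n (z : ℤ → A) :=
    (continuous_shiftZIter n).comp continuous_subtype_val
  have hfy : (f y : ℤ → A) = shiftZIter n y := by
    funext t
    refine hy {z | (f z : ℤ → A) t = shiftZIter n (z : ℤ → A) t}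
      (isClosed_apply_eq hfc hsc t t) ?_
    filter_upwards [Filter.eventually_ge_atTop (N - t).toNat] with j hj
    have h1 := hN (t + j) (by omega)
    change (f (u j) : ℤ → A) t = shiftZIter n (u j : ℤ → A) t
    rw [hf j x (u j) rfl]
    simp only [shiftZIter_apply, u] at h1 ⊢
    rw [h1, add_right_comm]
  have hclosedE : IsClosed {z : X | (f z : ℤ → A) = shiftZIter n (z : ℤ → A)} :=
    isClosed_eq hfc hsc
  have himage := hclosed.isClosedEmbedding_subtypeVal.isClosedMap _ hclosedE
  have hsub : orbitZ (y : ℤ → A) ⊆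
      Subtype.val '' {z : X | (f z : ℤ → A) = shiftZIter n (z : ℤ → A)} := by
    rintro _ ⟨j, rfl⟩
    let w : X := ⟨shiftZIter j y, shiftZIter_mem hinv _ y.2⟩
    refine ⟨w, ?_, rfl⟩
    change (f w : ℤ → A) = shiftZIter n (shiftZIter j y)
    rw [hf j y w rfl, hfy, shiftZIter_shiftZIter, shiftZIter_shiftZIter, add_comm]
  obtain ⟨w, hw, hwz⟩ := himage.closure_subset_iff.2 hsub (hmin y y.2 z.2)
  rw [← Subtype.ext hwz]
  exact hw

end Topology

section Transport

variable [TopologicalSpace A] {X : Set (ℤ → A)}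

/-- The action of a self-homeomorphism of `X` on sets of points. -/
def transport (Φ : X ≃ₜ X) (O : Set (ℤ → A)) : Set (ℤ → A) :=
  {y | ∃ x : X, (x : ℤ → A) ∈ O ∧ (Φ x : ℤ → A) = y}

theorem transport_symm_transport (Φ : X ≃ₜ X) {O : Set (ℤ → A)} (hO : O ⊆ X) :
    transport Φ.symm (transport Φ O) = O := by
  ext y
  constructor
  · rintro ⟨x, ⟨z, hz, hzx⟩, rfl⟩
    rw [← Subtype.ext hzx, Φ.symm_apply_apply]
    exact hz
  · intro hy
    exact ⟨Φ ⟨y, hO hy⟩, ⟨⟨y, hO hy⟩, hy, rfl⟩, by rw [Φ.symm_apply_apply]⟩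

theorem transport_orbitZ (hinv : shiftZ '' X = X) {Φ : X ≃ₜ X} (hΦ : IsAutZ X Φ) (x : X) :
    transport Φ (orbitZ (x : ℤ → A)) = orbitZ (Φ x : ℤ → A) := by
  have he := IsAutZ.shiftEquivariant hinv hΦ
  ext y
  constructor
  · rintro ⟨z, ⟨n, hn⟩, rfl⟩
    exact ⟨n, (he n x z hn.symm).symm⟩
  · rintro ⟨n, rfl⟩
    exact ⟨⟨shiftZIter n x, shiftZIter_mem hinv _ x.2⟩, ⟨n, rfl⟩, he n x _ rfl⟩

theorem transport_inter_eq_empty (Φ : X ≃ₜ X) {O O' : Set (ℤ → A)} (h : O ∩ O' = ∅) :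
    transport Φ O ∩ transport Φ O' = ∅ := by
  rw [Set.eq_empty_iff_forall_notMem] at h ⊢
  rintro _ ⟨⟨x, hx, rfl⟩, ⟨y, hy, hyx⟩⟩
  rw [Φ.injective (Subtype.ext hyx)] at hy
  exact h x ⟨hx, hy⟩

variable [DiscreteTopology A] [Finite A]

theorem OrbitsContainRA.transport (hclosed : IsClosed X) (hinv : shiftZ '' X = X)
    {Φ : X ≃ₜ X} (hΦ : IsAutZ X Φ) {O O' : Set (ℤ → A)} (hO : O ⊆ X) (hO' : O' ⊆ X)
    (h : OrbitsContainRA O O') :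
    OrbitsContainRA (transport Φ O) (transport Φ O') := by
  obtain ⟨p, hp, q, hq, hpq⟩ := h
  exact ⟨Φ ⟨p, hO hp⟩, ⟨⟨p, hO hp⟩, hp, rfl⟩, Φ ⟨q, hO' hq⟩, ⟨⟨q, hO' hq⟩, hq, rfl⟩,
    (IsAutZ.shiftEquivariant hinv hΦ).rightAsymptotic hclosed hinv Φ.continuous hpq⟩

theorem IsRAOrbit.transport (hclosed : IsClosed X) (hinv : shiftZ '' X = X)
    {Φ : X ≃ₜ X} (hΦ : IsAutZ X Φ) {O : Set (ℤ → A)} (h : IsRAOrbit X O) :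
    IsRAOrbit X (transport Φ O) := by
  have hO := IsRAOrbit.subset hinv h
  obtain ⟨⟨x, hx, rfl⟩, y, hy, hdisj, hra⟩ := h
  refine ⟨⟨Φ ⟨x, hx⟩, (Φ _).2, transport_orbitZ hinv hΦ ⟨x, hx⟩⟩,
    Φ ⟨y, hy⟩, (Φ _).2, ?_, ?_⟩ <;> rw [← transport_orbitZ hinv hΦ ⟨y, hy⟩]
  · exact transport_inter_eq_empty Φ hdisj
  · exact OrbitsContainRA.transport hclosed hinv hΦ hO (orbitZ_subset hinv hy) hra

theorem transport_mem_simClass (hclosed : IsClosed X) (hinv : shiftZ '' X = X)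
    {Φ : X ≃ₜ X} (hΦ : IsAutZ X Φ) {O O' : Set (ℤ → A)} (hO : IsRAOrbit X O)
    (h : O' ∈ SimClass X O) : transport Φ O' ∈ SimClass X (transport Φ O) := by
  obtain ⟨h1, h2⟩ := h
  refine ⟨IsRAOrbit.transport hclosed hinv hΦ h1, ?_⟩
  rcases h2 with rfl | h2
  · exact simRA_refl _
  · exact Or.inr (OrbitsContainRA.transport hclosed hinv hΦ (IsRAOrbit.subset hinv hO)
      (IsRAOrbit.subset hinv h1) h2)

theorem simClass_transport (hclosed : IsClosed X) (hinv : shiftZ '' X = X)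
    {Φ : X ≃ₜ X} (hΦ : IsAutZ X Φ) {O : Set (ℤ → A)} (hO : IsRAOrbit X O) :
    SimClass X (transport Φ O) = transport Φ '' SimClass X O := by
  ext O'
  constructor
  · intro h
    refine ⟨transport Φ.symm O', ?_, ?_⟩
    · have := transport_mem_simClass hclosed hinv (IsAutZ.symm hinv hΦ)
        (IsRAOrbit.transport hclosed hinv hΦ hO) h
      rwa [transport_symm_transport Φ (IsRAOrbit.subset hinv hO)] at this
    · exact transport_symm_transport Φ.symm (IsRAOrbit.subset hinv h.1)
  · rintro ⟨O'', h, rfl⟩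
    exact transport_mem_simClass hclosed hinv hΦ hO h

theorem ncard_simClass_transport (hclosed : IsClosed X) (hinv : shiftZ '' X = X)
    {Φ : X ≃ₜ X} (hΦ : IsAutZ X Φ) {O : Set (ℤ → A)} (hO : IsRAOrbit X O) :
    (SimClass X (transport Φ O)).ncard = (SimClass X O).ncard := by
  rw [simClass_transport hclosed hinv hΦ hO]
  refine Set.InjOn.ncard_image fun O₁ h₁ O₂ h₂ h => ?_
  rw [← transport_symm_transport Φ (IsRAOrbit.subset hinv h₁.1), h,
    transport_symm_transport Φ (IsRAOrbit.subset hinv h₂.1)]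

/-- Every automorphism has a power `Φ^m`, with `m` at most the number of classes of
size `k`, that is a power of the shift. -/
theorem exists_iterate_eq_shiftZIter (hclosed : IsClosed X) (hinv : shiftZ '' X = X)
    (hmin : MinimalZ X) {Φ : X ≃ₜ X} (hΦ : IsAutZ X Φ) {k : ℕ}
    (hk : 1 ≤ numRAClassesOfSize X k) :
    ∃ m : ℕ, 1 ≤ m ∧ m ≤ numRAClassesOfSize X k ∧
      ∃ n : ℤ, ∀ x : X, ((⇑Φ)^[m] x : ℤ → A) = shiftZIter n (x : ℤ → A) := by
  have he := IsAutZ.shiftEquivariant hinv hΦ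
  obtain ⟨⟨⟨C, ⟨O, hO, rfl⟩, hcard⟩⟩, hfin⟩ := Nat.card_pos_iff.1 hk
  obtain ⟨⟨x₀, hx₀, rfl⟩, -⟩ := id hO
  let x : ℕ → X := fun i => Φ^[i] ⟨x₀, hx₀⟩
  have hx : ∀ i, IsRAOrbit X (orbitZ (x i : ℤ → A)) ∧
      (SimClass X (orbitZ (x i : ℤ → A))).ncard = k := by
    intro i
    induction i with
    | zero => exact ⟨hO, hcard⟩
    | succ i ih =>
      have e : x (i + 1) = Φ (x i) := Function.iterate_succ_apply' _ _ _
      rw [e, ← transport_orbitZ hinv hΦ]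
      exact ⟨IsRAOrbit.transport hclosed hinv hΦ ih.1,
        (ncard_simClass_transport hclosed hinv hΦ ih.1).trans ih.2⟩
  let cls : Fin (numRAClassesOfSize X k + 1) → {C : Set (Set (ℤ → A)) //
      (∃ O, IsRAOrbit X O ∧ C = SimClass X O) ∧ C.ncard = k} :=
    fun i => ⟨_, ⟨_, (hx i).1, rfl⟩, (hx i).2⟩
  have hninj : ¬ Function.Injective cls := by
    intro hi
    have := Nat.card_le_card_of_injective cls hi
    rw [Nat.card_eq_fintype_card, Fintype.card_fin] at this
    exact absurd this (Nat.not_succ_le_self _)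
  have hlt : ∃ i j : Fin (numRAClassesOfSize X k + 1), i < j ∧ cls i = cls j := by
    rw [Function.not_injective_iff] at hninj
    obtain ⟨i, j, hij, hne⟩ := hninj
    rcases lt_or_gt_of_ne hne with h | h
    exacts [⟨i, j, h, hij⟩, ⟨j, i, h, hij.symm⟩]
  obtain ⟨i, j, hij, hcls⟩ := hlt
  have hij' : (i : ℕ) < j := hij
  have hmem : orbitZ (x i : ℤ → A) ∈ SimClass X (orbitZ (x j : ℤ → A)) := by
    have h : SimClass X (orbitZ (x i : ℤ → A)) = SimClass X (orbitZ (x j : ℤ → A)) :=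
      congrArg Subtype.val hcls
    exact h ▸ ⟨(hx i).1, simRA_refl _⟩
  obtain ⟨n, hn⟩ := exists_rightAsymptotic_shift_of_simRA hmem.2
  refine ⟨j - i, by omega, by omega, n, ?_⟩
  have e : x j = Φ^[(j : ℕ) - i] (x i) := by
    simp only [x]
    rw [← Function.iterate_add_apply, Nat.sub_add_cancel hij'.le]
  rw [e] at hn
  exact (he.iterate _).eq_shiftZIter hclosed hinv hmin (Φ.continuous.iterate _) hn

end Transport

section Tails

/-- The right-infinite tail of `x` starting at `m`. -/
def rightTail (x : ℤ → A) (m : ℤ) : ℕ → A := fun k => x (m + k)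

/-- Prepend a letter to a one-sided sequence. -/
def prepend (a : A) (t : ℕ → A) : ℕ → A
  | 0 => a
  | k + 1 => t k

/-- Remove the first letter of a one-sided sequence. -/
def dropFirst (t : ℕ → A) : ℕ → A := fun k => t (k + 1)

/-- The one-sided sequences read in the points of `X`. -/
def tails (X : Set (ℤ → A)) : Set (ℕ → A) := {t | ∃ x ∈ X, rightTail x 0 = t}

/-- The tails whose first letter is not the one selected by `c`. -/
def branches (X : Set (ℤ → A)) (c : (ℕ → A) → A) : Set (ℕ → A) :=
  {t | t ∈ tails X ∧ t 0 ≠ c (dropFirst t)}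

theorem rightTail_shiftZIter (x : ℤ → A) (n m : ℤ) :
    rightTail (shiftZIter n x) m = rightTail x (m + n) := by
  funext k
  simp only [rightTail, shiftZIter_apply]
  congr 1
  ring

theorem prepend_rightTail (x : ℤ → A) (m : ℤ) :
    prepend (x m) (rightTail x (m + 1)) = rightTail x m := by
  funext k
  cases k with
  | zero => simp [prepend, rightTail]
  | succ k =>
    simp only [prepend, rightTail]
    congr 1
    push_cast
    ring

theorem dropFirst_rightTail (x : ℤ → A) (m : ℤ) :
    dropFirst (rightTail x m) = rightTail x (m + 1) := by
  rw [← prepend_rightTail]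
  rfl

theorem ext_of_head_of_dropFirst {s t : ℕ → A} (h0 : s 0 = t 0)
    (h : dropFirst s = dropFirst t) : s = t := by
  funext k
  cases k with
  | zero => exact h0
  | succ k => exact congrFun h k

variable {X : Set (ℤ → A)}

theorem rightTail_mem_tails (hinv : shiftZ '' X = X) {x : ℤ → A} (hx : x ∈ X) (m : ℤ) :
    rightTail x m ∈ tails X :=
  ⟨_, shiftZIter_mem hinv m hx, by rw [rightTail_shiftZIter, zero_add]⟩

theorem exists_prepend_mem_tails (hinv : shiftZ '' X = X) {t : ℕ → A} (ht : t ∈ tails X) :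
    ∃ a, prepend a t ∈ tails X := by
  obtain ⟨x, hx, rfl⟩ := ht
  refine ⟨x (-1), ?_⟩
  have := prepend_rightTail x (-1)
  rw [neg_add_cancel] at this
  rw [this]
  exact rightTail_mem_tails hinv hx _

theorem exists_branch_of_ne (hinv : shiftZ '' X = X) (c : (ℕ → A) → A) {x y : ℤ → A}
    (hx : x ∈ X) (hy : y ∈ X) (hne : x ≠ y) (h : RightAsymptotic x y) :
    ∃ n, x n ≠ y n ∧ (rightTail x n ∈ branches X c ∨ rightTail y n ∈ branches X c) := by
  obtain ⟨N, hN⟩ := h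
  obtain ⟨n, hn, hmax⟩ := Int.exists_greatest_of_bdd (P := fun n => x n ≠ y n)
    ⟨N, fun n hn => by
      by_contra hlt
      exact hn (hN n (by omega))⟩ (Function.ne_iff.1 hne)
  refine ⟨n, hn, ?_⟩
  have htail : rightTail x (n + 1) = rightTail y (n + 1) := by
    funext k
    by_contra hk
    have := hmax _ hk
    omega
  by_contra! hcon
  have h1 : ∀ z ∈ X, rightTail z n ∉ branches X c → z n = c (rightTail z (n + 1)) := by
    intro z hz hzb
    by_contra hzn
    refine hzb ⟨rightTail_mem_tails hinv hz n, ?_⟩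
    rw [dropFirst_rightTail]
    simpa [rightTail] using hzn
  exact hn (by rw [h1 x hx hcon.1, h1 y hy hcon.2, htail])

/-- The words of length `n` occurring in `X` are the prefixes of its tails. -/
theorem language_eq_image (hinv : shiftZ '' X = X) (n : ℕ) :
    {w : Fin n → A | ∃ x ∈ X, ∃ i : ℤ, ∀ j : Fin n, w j = x (i + (j : ℕ))} =
      (fun (t : ℕ → A) (j : Fin n) => t j) '' tails X := by
  ext w
  constructor
  · rintro ⟨x, hx, i, h⟩
    exact ⟨_, rightTail_mem_tails hinv hx i, funext fun j => (h j).symm⟩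
  · rintro ⟨_, ⟨x, hx, rfl⟩, rfl⟩
    exact ⟨x, hx, 0, fun j => rfl⟩

variable [Fintype A]

theorem complexityZ_add_card_le (hinv : shiftZ '' X = X) {c : (ℕ → A) → A}
    (hc : ∀ t ∈ tails X, prepend (c t) t ∈ tails X) {G : Finset (ℕ → A)}
    (hG : ↑G ⊆ branches X c) {n : ℕ}
    (hn : ∀ g ∈ G, ∀ h ∈ G, (∀ k < n, dropFirst g k = dropFirst h k) →
      dropFirst g = dropFirst h) :
    complexityZ X n + G.card ≤ complexityZ X (n + 1) := by
  unfold complexityZ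
  rw [Nat.card_coe_set_eq, Nat.card_coe_set_eq, language_eq_image hinv, language_eq_image hinv]
  let r : (m : ℕ) → (ℕ → A) → Fin m → A := fun m t j => t j
  change (r n '' tails X).ncard + G.card ≤ (r (n + 1) '' tails X).ncard
  have hpre : ∀ s t : ℕ → A, r n s = r n t → ∀ k < n, s k = t k :=
    fun s t h k hk => congrFun h ⟨k, hk⟩
  have hdrop : ∀ s : ℕ → A, Fin.tail (r (n + 1) s) = r n (dropFirst s) := fun s => rfl
  have hinj : Set.InjOn (r (n + 1)) G := by
    intro g hg h hh hgh
    refine ext_of_head_of_dropFirst (congrFun hgh 0) (hn g hg h hh (hpre _ _ ?_))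
    rw [← hdrop, ← hdrop, hgh]
  have hGP : r (n + 1) '' G ⊆ r (n + 1) '' tails X :=
    Set.image_mono fun g hg => (hG hg).1
  have hcover : r n '' tails X ⊆ Fin.tail '' (r (n + 1) '' tails X \ r (n + 1) '' G) := by
    rintro _ ⟨t, ht, rfl⟩
    by_cases hex : ∃ g ∈ G, r n (dropFirst g) = r n t
    · obtain ⟨g, hg, hgt⟩ := hex
      have hgtails : dropFirst g ∈ tails X := by
        obtain ⟨x, hx, rfl⟩ := (hG hg).1
        rw [dropFirst_rightTail]
        exact rightTail_mem_tails hinv hx _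
      refine ⟨r (n + 1) (prepend (c (dropFirst g)) (dropFirst g)),
        ⟨⟨_, hc _ hgtails, rfl⟩, ?_⟩, hgt⟩
      rintro ⟨h, hh, hhg⟩
      have h1 : dropFirst h = dropFirst g := hn h hh g hg (hpre _ _ (congrArg Fin.tail hhg))
      refine (hG hh).2 ?_
      rw [h1]
      exact congrFun hhg 0
    · refine ⟨r (n + 1) (prepend (c t) t), ⟨⟨_, hc _ ht, rfl⟩, ?_⟩, rfl⟩
      rintro ⟨h, hh, hht⟩
      exact hex ⟨h, hh, congrArg Fin.tail hht⟩
  have h1 := (Set.ncard_le_ncard hcover).trans (Set.ncard_image_le (Set.toFinite _))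
  have h2 := Set.ncard_sdiff_add_ncard_of_subset hGP
  rw [hinj.ncard_image, Set.ncard_coe_finset] at h2
  omega

/-- Sublinear complexity forces the set of branches to be finite. -/
theorem finite_branches (hinv : shiftZ '' X = X) (hsub : SublinearComplexityZ X)
    {c : (ℕ → A) → A} (hc : ∀ t ∈ tails X, prepend (c t) t ∈ tails X) :
    (branches X c).Finite := by
  by_contra hinf
  obtain ⟨C, hC⟩ := hsub
  obtain ⟨G, hG, hcard⟩ := Set.Infinite.exists_subset_card_eq hinf (C + 1)
  have hsep : ∃ N : ℕ, ∀ g ∈ G, ∀ h ∈ G, (∀ k < N, dropFirst g k = dropFirst h k) →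
      dropFirst g = dropFirst h := by
    have hpair : ∀ g h : ℕ → A, ∃ N : ℕ, (∀ k < N, g k = h k) → g = h := by
      intro g h
      by_cases hgh : g = h
      · exact ⟨0, fun _ => hgh⟩
      · obtain ⟨k, hk⟩ := Function.ne_iff.1 hgh
        exact ⟨k + 1, fun H => absurd (H k (Nat.lt_succ_self k)) hk⟩
    choose N hN using hpair
    refine ⟨(G ×ˢ G).sup fun p => N (dropFirst p.1) (dropFirst p.2), fun g hg h hh H => ?_⟩
    refine hN _ _ fun k hk => H k (hk.trans_le ?_)
    exact Finset.le_sup (f := fun p : (ℕ → A) × (ℕ → A) => N (dropFirst p.1) (dropFirst p.2))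
      (Finset.mk_mem_product hg hh)
  obtain ⟨N, hN⟩ := hsep
  have hgrow : ∀ j : ℕ, j * (C + 1) ≤ complexityZ X (N + j) := by
    intro j
    induction j with
    | zero => simp
    | succ j ih =>
      have := complexityZ_add_card_le hinv hc hG (n := N + j) fun g hg h hh H =>
        hN g hg h hh fun k hk => H k (by omega)
      rw [hcard] at this
      rw [← add_assoc, Nat.succ_mul]
      omega
  have h1 := hgrow (C * N + 1)
  have h2 := hC (N + (C * N + 1)) (by omega)
  nlinarith

end Tails

section Finiteness

variable [Fintype A] [TopologicalSpace A] [DiscreteTopology A] {X : Set (ℤ → A)}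

theorem rightTail_injective (hclosed : IsClosed X) (hinv : shiftZ '' X = X)
    (hmin : MinimalZ X) (hinf : X.Infinite) {x : ℤ → A} (hx : x ∈ X) :
    Function.Injective (rightTail x) := by
  intro m m' h
  by_contra hne
  refine not_eventually_periodic hclosed hinv hmin hinf hx (d := m' - m) (by omega)
    ⟨m, fun n hn => ?_⟩
  have := congrFun h (n - m).toNat
  simp only [rightTail, Int.toNat_of_nonneg (sub_nonneg.2 hn)] at this
  rw [shiftZIter_apply, show n + (m' - m) = m' + (n - m) by ring, ← this]
  congr 1
  ring

theorem finite_setOf_isRAOrbit (hclosed : IsClosed X) (hinv : shiftZ '' X = X)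
    (hmin : MinimalZ X) (hinf : X.Infinite) (hsub : SublinearComplexityZ X) :
    {O | IsRAOrbit X O}.Finite := by
  obtain ⟨x₀, -⟩ := hinf.nonempty
  have : Nonempty A := ⟨x₀ 0⟩
  have hex : ∀ t : ℕ → A, ∃ a, t ∈ tails X → prepend a t ∈ tails X := by
    intro t
    by_cases ht : t ∈ tails X
    · obtain ⟨a, ha⟩ := exists_prepend_mem_tails hinv ht
      exact ⟨a, fun _ => ha⟩
    · exact ⟨Classical.arbitrary A, fun h => absurd h ht⟩
  choose c hc using hex
  have hF := finite_branches hinv hsub hc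
  let B : Set (ℤ → A) := {x | x ∈ X ∧ rightTail x 0 ∈ branches X c ∧
    ∀ m < 0, rightTail x m ∉ branches X c}
  have hB : B.Finite := by
    refine Set.Finite.of_injOn (f := fun x => rightTail x 0) (t := branches X c)
      (fun x hx => hx.2.1) ?_ hF
    intro x hx y hy hxy
    by_contra hne
    have hagree : ∀ n : ℤ, 0 ≤ n → x n = y n := fun n hn => by
      have := congrFun hxy n.toNat
      simpa [rightTail, Int.toNat_of_nonneg hn] using this
    obtain ⟨n, hn, hb⟩ := exists_branch_of_ne hinv c hx.1 hy.1 hne ⟨0, hagree⟩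
    have hneg : n < 0 := by
      by_contra hcon
      exact hn (hagree n (by omega))
    rcases hb with hb | hb
    exacts [hx.2.2 n hneg hb, hy.2.2 n hneg hb]
  let U : (ℤ → A) → Set (ℤ → A) := fun y => {x | x ∈ X ∧ (∀ m, rightTail x m ∉ branches X c) ∧
    RightAsymptotic x y}
  have hU : ∀ y, (U y).Subsingleton := by
    intro y x hx x' hx'
    by_contra hne
    obtain ⟨n, -, hb⟩ := exists_branch_of_ne hinv c hx.1 hx'.1 hne
      (RightAsymptotic.trans hx.2.2 (RightAsymptotic.symm hx'.2.2))
    rcases hb with hb | hb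
    exacts [hx.2.1 n hb, hx'.2.1 n hb]
  have hfirst : ∀ x ∈ X, {m | rightTail x m ∈ branches X c}.Nonempty → ∃ m, shiftZIter m x ∈ B := by
    intro x hx hne
    have hfin : {m | rightTail x m ∈ branches X c}.Finite :=
      hF.preimage (rightTail_injective hclosed hinv hmin hinf hx).injOn
    obtain ⟨m, hm, hmle⟩ := Set.exists_min_image _ id hfin hne
    refine ⟨m, shiftZIter_mem hinv m hx, ?_, fun k hk hkb => ?_⟩
    · rw [rightTail_shiftZIter, zero_add]
      exact hm
    · rw [rightTail_shiftZIter] at hkb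
      have : m ≤ k + m := hmle _ hkb
      omega
  refine ((hB.union (hB.biUnion fun y _ => (hU y).finite)).image orbitZ).subset ?_
  rintro _ ⟨⟨x, hx, rfl⟩, y, hy, hdisj, p, hp, q, hq, hpq⟩
  have hpX := orbitZ_subset hinv hx hp
  have hqX := orbitZ_subset hinv hy hq
  have hne : p ≠ q := by
    rintro rfl
    exact Set.eq_empty_iff_forall_notMem.1 hdisj p ⟨hp, hq⟩
  by_cases hpb : ∃ m, rightTail p m ∈ branches X c
  · obtain ⟨m, hm⟩ := hfirst p hpX hpb
    exact ⟨_, Or.inl hm, (orbitZ_shiftZIter m p).trans (orbitZ_eq_of_mem hp)⟩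
  · push Not at hpb
    obtain ⟨n, -, hb⟩ := exists_branch_of_ne hinv c hpX hqX hne hpq
    obtain ⟨m, hm⟩ := hfirst q hqX ⟨n, hb.resolve_left (hpb n)⟩
    refine ⟨shiftZIter m p, Or.inr (Set.mem_biUnion hm ⟨shiftZIter_mem hinv m hpX, ?_,
      RightAsymptotic.shift hpq m⟩), (orbitZ_shiftZIter m p).trans (orbitZ_eq_of_mem hp)⟩
    intro k
    rw [rightTail_shiftZIter]
    exact hpb _

theorem exists_one_le_numRAClassesOfSize (hclosed : IsClosed X) (hinv : shiftZ '' X = X)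
    (hmin : MinimalZ X) (hinf : X.Infinite) (hsub : SublinearComplexityZ X) :
    ∃ k : ℕ, 2 ≤ k ∧ 1 ≤ numRAClassesOfSize X k := by
  have hfin := finite_setOf_isRAOrbit hclosed hinv hmin hinf hsub
  obtain ⟨x, hx, y, hy, hdisj, hra⟩ := exists_disjoint_rightAsymptotic hclosed hinv hmin hinf
  have hOx : IsRAOrbit X (orbitZ x) := ⟨⟨x, hx, rfl⟩, y, hy, hdisj,
    x, mem_orbitZ_self x, y, mem_orbitZ_self y, hra⟩
  have hOy : IsRAOrbit X (orbitZ y) := ⟨⟨y, hy, rfl⟩, x, hx, by rwa [Set.inter_comm],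
    y, mem_orbitZ_self y, x, mem_orbitZ_self x, RightAsymptotic.symm hra⟩
  have hne : orbitZ x ≠ orbitZ y := by
    intro h
    rw [← h, Set.inter_self] at hdisj
    exact Set.eq_empty_iff_forall_notMem.1 hdisj x (mem_orbitZ_self x)
  refine ⟨(SimClass X (orbitZ x)).ncard, ?_, ?_⟩
  · have hsub2 : {orbitZ x, orbitZ y} ⊆ SimClass X (orbitZ x) := by
      rintro O (rfl | rfl)
      · exact ⟨hOx, simRA_refl _⟩
      · exact ⟨hOy, Or.inr ⟨x, mem_orbitZ_self x, y, mem_orbitZ_self y, hra⟩⟩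
    rw [← Set.ncard_pair hne]
    exact Set.ncard_le_ncard hsub2 (hfin.subset fun O h => h.1)
  · refine Nat.card_pos_iff.2 ⟨⟨⟨_, ⟨_, hOx, rfl⟩, rfl⟩⟩, ?_⟩
    refine (hfin.finite_subsets.subset ?_).to_subtype
    rintro C ⟨⟨O, -, rfl⟩, -⟩
    exact fun O' h => h.1

end Finiteness

end TwoSidedShift

/-- For an infinite minimal two-sided shift with sublinear complexity,
some `k ≥ 2` admits a `∼`-class of right asymptotic orbits of size `k`, and for each such
`k`, every automorphism `Φ` satisfies `Φ^m = σ̄^n` for some `1 ≤ m ≤ M̄_k` and `n ∈ ℤ`;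
hence every automorphism is at most an `M̄`-th root of a power of the shift, where
`M̄ = min M̄_k`. -/
theorem aut_root_of_shift_le_min_RA_classes
    {A : Type*} [Fintype A] [TopologicalSpace A] [DiscreteTopology A]
    (X : Set (ℤ → A)) (hne : X.Nonempty) (hclosed : IsClosed X)
    (hinv : shiftZ '' X = X)
    (hmin : MinimalZ X) (hinf : X.Infinite)
    (hsub : SublinearComplexityZ X) :
    (∃ k : ℕ, 2 ≤ k ∧ 1 ≤ numRAClassesOfSize X k) ∧
      ∀ Φ : X ≃ₜ X, IsAutZ X Φ →
        ∀ k : ℕ, 2 ≤ k → 1 ≤ numRAClassesOfSize X k →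
          ∃ m : ℕ, 1 ≤ m ∧ m ≤ numRAClassesOfSize X k ∧
            ∃ n : ℤ, ∀ x : X, ((⇑Φ)^[m] x : ℤ → A) = shiftZIter n (x : ℤ → A) := by
  exact ⟨TwoSidedShift.exists_one_le_numRAClassesOfSize hclosed hinv hmin hinf hsub,
    fun Φ hΦ k _ hk => TwoSidedShift.exists_iterate_eq_shiftZIter hclosed hinv hmin hΦ hk⟩
end

section
/- Let (X,σ) be an infinite minimal one-sided shift. Then (X,σ) has sublinear complexity if and only if there exists a constant L such that p(n+1) − p(n) ≤ L for all n ≥ 1. -/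
open Finset in
theorem card_add_card_le_of_fibers {α β : Type*} [DecidableEq β] (s : Finset α) (t r : Finset β)
    (f : α → β) (hf : ∀ a ∈ s, f a ∈ t) (hr : r ⊆ t)
    (h1 : ∀ b ∈ t, 1 ≤ #{a ∈ s | f a = b}) (h2 : ∀ b ∈ r, 2 ≤ #{a ∈ s | f a = b}) :
    #t + #r ≤ #s := by
  rw [card_eq_sum_card_fiberwise (f := f) (s := s) (t := t) hf, ← sum_sdiff hr]
  have e1 : #(t \ r) * 1 ≤ ∑ b ∈ t \ r, #{a ∈ s | f a = b} := by
    simpa using card_nsmul_le_sum (t \ r) _ 1 fun b hb => h1 b (mem_sdiff.1 hb).1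
  have e2 : #r * 2 ≤ ∑ b ∈ r, #{a ∈ s | f a = b} := by
    simpa using card_nsmul_le_sum r _ 2 h2
  have := card_sdiff_add_card_eq_card hr
  omega

open Finset in
theorem card_le_card_add_mul_of_fibers {α β : Type*} [DecidableEq β] (s : Finset α)
    (t r : Finset β) (f : α → β) (k : ℕ) (hf : ∀ a ∈ s, f a ∈ t) (hr : r ⊆ t)
    (h1 : ∀ b ∈ t, b ∉ r → #{a ∈ s | f a = b} ≤ 1) (h2 : ∀ b ∈ r, #{a ∈ s | f a = b} ≤ k) :
    #s ≤ #t + k * #r := by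
  rw [card_eq_sum_card_fiberwise (f := f) (s := s) (t := t) hf, ← sum_sdiff hr]
  have e1 : ∑ b ∈ t \ r, #{a ∈ s | f a = b} ≤ #(t \ r) * 1 := by
    simpa using sum_le_card_nsmul (t \ r) _ 1
      fun b hb => h1 b (mem_sdiff.1 hb).1 (mem_sdiff.1 hb).2
  have e2 : ∑ b ∈ r, #{a ∈ s | f a = b} ≤ #r * k := by
    simpa using sum_le_card_nsmul r _ k h2
  have := card_sdiff_add_card_eq_card hr
  rw [mul_comm k]
  omega

section Factors

variable {A : Type*}

/-- The factor of length `n` of the sequence `x` at position `i`. -/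
def factorAt (x : ℕ → A) (n i : ℕ) : Fin n → A := fun j => x (i + j)

theorem factorAt_eq_iff {x : ℕ → A} {n i j : ℕ} :
    factorAt x n i = factorAt x n j ↔ ∀ k < n, x (i + k) = x (j + k) :=
  ⟨fun h k hk => congrFun h ⟨k, hk⟩, fun h => funext fun k => h k k.2⟩

/-- The factor of length `m + 1` of `x` at position `e` has a period `d ≥ 1` with `2 * d ≤ m`. -/
def HasShortPeriodAt (x : ℕ → A) (m e : ℕ) : Prop :=
  ∃ d, 1 ≤ d ∧ 2 * d ≤ m ∧ ∀ s, s + d ≤ m → x (e + s + d) = x (e + s)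

/-- A word has at most one right extension with a short period. -/
theorem HasShortPeriodAt.eq_of_eq {x : ℕ → A} {m e f : ℕ} (he : HasShortPeriodAt x m e)
    (hf : HasShortPeriodAt x m f) (h : ∀ s < m, x (e + s) = x (f + s)) :
    x (e + m) = x (f + m) := by
  obtain ⟨d, hd, hdm, hp⟩ := he
  obtain ⟨d', hd', hdm', hp'⟩ := hf
  have a1 := hp (m - d) (by omega)
  have a2 := h (m - d) (by omega)
  have a3 := hp' (m - d - d') (by omega)
  have b1 := hp' (m - d') (by omega)
  have b2 := h (m - d') (by omega)
  have b3 := hp (m - d - d') (by omega)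
  have b4 := h (m - d - d') (by omega)
  rw [show e + (m - d) + d = e + m by omega] at a1
  rw [show f + (m - d - d') + d' = f + (m - d) by omega] at a3
  rw [show f + (m - d') + d' = f + m by omega] at b1
  rw [show e + (m - d - d') + d = e + (m - d') by omega] at b3
  rw [a1, a2, a3, b1, ← b2, b3, b4]

theorem HasShortPeriodAt.congr {x : ℕ → A} {m e f : ℕ} (he : HasShortPeriodAt x m e)
    (h : ∀ s ≤ m, x (e + s) = x (f + s)) : HasShortPeriodAt x m f := by
  obtain ⟨d, hd, hdm, hp⟩ := he
  refine ⟨d, hd, hdm, fun s hs => ?_⟩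
  rw [add_assoc, ← h _ hs, ← h s (by omega), ← add_assoc, hp s hs]

/-- The suffix of length `m` of a word of length `n`. -/
def suffixWord {n m : ℕ} (h : m ≤ n) (w : Fin n → A) : Fin m → A :=
  fun s => w ⟨n - m + s, by omega⟩

theorem suffixWord_factorAt {n m : ℕ} (h : m ≤ n) (x : ℕ → A) (i : ℕ) :
    suffixWord h (factorAt x n i) = factorAt x m (i + (n - m)) := by
  funext s
  simp [suffixWord, factorAt, add_assoc]

variable [Fintype A]

open Classical in
/-- The set of factors of length `n` of `x`. -/
noncomputable def factors (x : ℕ → A) (n : ℕ) : Finset (Fin n → A) :=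
  Finset.univ.filter fun w => ∃ i, factorAt x n i = w

open Classical in
/-- The set of right special factors of length `n` of `x`. -/
noncomputable def rightSpecial (x : ℕ → A) (n : ℕ) : Finset (Fin n → A) :=
  Finset.univ.filter fun w =>
    ∃ i j, factorAt x n i = w ∧ factorAt x n j = w ∧ x (i + n) ≠ x (j + n)

theorem mem_factors {x : ℕ → A} {n : ℕ} {w : Fin n → A} :
    w ∈ factors x n ↔ ∃ i, factorAt x n i = w := by simp [factors]

theorem mem_rightSpecial {x : ℕ → A} {n : ℕ} {w : Fin n → A} :
    w ∈ rightSpecial x n ↔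
      ∃ i j, factorAt x n i = w ∧ factorAt x n j = w ∧ x (i + n) ≠ x (j + n) := by
  simp [rightSpecial]

theorem rightSpecial_subset (x : ℕ → A) (n : ℕ) : rightSpecial x n ⊆ factors x n := fun w hw => by
  obtain ⟨i, _, h, _⟩ := mem_rightSpecial.1 hw
  exact mem_factors.2 ⟨i, h⟩

theorem init_mem_factors {x : ℕ → A} {n : ℕ} {w : Fin (n + 1) → A} (hw : w ∈ factors x (n + 1)) :
    Fin.init w ∈ factors x n := by
  obtain ⟨i, rfl⟩ := mem_factors.1 hw
  exact mem_factors.2 ⟨i, rfl⟩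

open Finset Classical in
theorem card_factors_add_card_rightSpecial_le (x : ℕ → A) (n : ℕ) :
    #(factors x n) + #(rightSpecial x n) ≤ #(factors x (n + 1)) := by
  refine card_add_card_le_of_fibers _ _ _ Fin.init (fun w => init_mem_factors)
    (rightSpecial_subset x n) (fun w hw => ?_) (fun w hw => ?_)
  · obtain ⟨i, rfl⟩ := mem_factors.1 hw
    exact card_pos.2 ⟨factorAt x (n + 1) i, mem_filter.2 ⟨mem_factors.2 ⟨i, rfl⟩, rfl⟩⟩
  · obtain ⟨i, j, hi, hj, hij⟩ := mem_rightSpecial.1 hw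
    refine one_lt_card.2 ⟨factorAt x (n + 1) i, mem_filter.2 ⟨mem_factors.2 ⟨i, rfl⟩, hi⟩,
      factorAt x (n + 1) j, mem_filter.2 ⟨mem_factors.2 ⟨j, rfl⟩, hj⟩, fun h => hij ?_⟩
    exact factorAt_eq_iff.1 h n (by omega)

open Finset Classical in
theorem card_factors_succ_le (x : ℕ → A) (n : ℕ) :
    #(factors x (n + 1)) ≤ #(factors x n) + Fintype.card A * #(rightSpecial x n) := by
  refine card_le_card_add_mul_of_fibers _ _ _ Fin.init _ (fun w => init_mem_factors)
    (rightSpecial_subset x n) (fun w hw hs => ?_) (fun w hw => ?_)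
  · refine card_le_one.2 fun u hu v hv => ?_
    obtain ⟨hu, hu'⟩ := mem_filter.1 hu
    obtain ⟨hv, hv'⟩ := mem_filter.1 hv
    obtain ⟨i, rfl⟩ := mem_factors.1 hu
    obtain ⟨j, rfl⟩ := mem_factors.1 hv
    by_contra hne
    refine hs (mem_rightSpecial.2 ⟨i, j, hu', hv', fun h => hne ?_⟩)
    refine factorAt_eq_iff.2 fun k hk => ?_
    rcases Nat.lt_succ_iff_lt_or_eq.1 hk with hk | rfl
    · exact factorAt_eq_iff.1 (hu'.trans hv'.symm : factorAt x n i = factorAt x n j) k hk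
    · exact h
  · refine card_le_card_of_injOn (fun u : Fin (n + 1) → A => u (Fin.last n))
      (t := (univ : Finset A)) (by simp) ?_
    intro u hu v hv huv
    have hu := (mem_filter.1 (mem_coe.1 hu)).2
    have hv := (mem_filter.1 (mem_coe.1 hv)).2
    rw [← Fin.snoc_init_self u, ← Fin.snoc_init_self v, hu, hv]
    exact congrArg (Fin.snoc (α := fun _ => A) w) (show u (Fin.last n) = v (Fin.last n) from huv)

theorem suffixWord_mem_rightSpecial {x : ℕ → A} {n m : ℕ} (h : m ≤ n) {w : Fin n → A}
    (hw : w ∈ rightSpecial x n) : suffixWord h w ∈ rightSpecial x m := by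
  obtain ⟨i, j, rfl, hj, hij⟩ := mem_rightSpecial.1 hw
  refine mem_rightSpecial.2 ⟨i + (n - m), j + (n - m), (suffixWord_factorAt h x i).symm, ?_, ?_⟩
  · rw [← hj, suffixWord_factorAt]
  · rwa [show i + (n - m) + m = i + n by omega, show j + (n - m) + m = j + n by omega]

/-- Every factor of `x` occurs at arbitrarily large positions. -/
def IsRecurrentSeq (x : ℕ → A) : Prop :=
  ∀ n i N, ∃ j, N ≤ j ∧ factorAt x n j = factorAt x n i

theorem exists_not_hasShortPeriodAt {x : ℕ → A} (hx : IsRecurrentSeq x) {n m : ℕ} (h : m ≤ n)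
    (l : ℕ) {w : Fin n → A} (hw : w ∈ rightSpecial x n) :
    ∃ i, l ≤ i ∧ factorAt x n i = w ∧ ¬ HasShortPeriodAt x m (i + (n - m)) := by
  obtain ⟨i, j, hi, hj, hij⟩ := mem_rightSpecial.1 hw
  obtain ⟨i, hi, hb⟩ : ∃ i, factorAt x n i = w ∧ ¬ HasShortPeriodAt x m (i + (n - m)) := by
    by_contra! hcon
    have := (hcon i hi).eq_of_eq (hcon j hj) fun s hs => by
      have := factorAt_eq_iff.1 (hi.trans hj.symm) (n - m + s) (by omega)
      rwa [← add_assoc, ← add_assoc] at this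
    rw [show i + (n - m) + m = i + n by omega, show j + (n - m) + m = j + n by omega] at this
    exact hij this
  obtain ⟨k, hk, hki⟩ := hx (n + 1) i l
  rw [factorAt_eq_iff] at hki
  refine ⟨k, hk, ?_, fun hc => hb (hc.congr fun s hs => ?_)⟩
  · rw [← hi]
    exact factorAt_eq_iff.2 fun t ht => hki t (by omega)
  · have := hki (n - m + s) (by omega)
    rwa [← add_assoc, ← add_assoc] at this

open Finset Classical in
theorem card_rightSpecial_fiber_mul_le {x : ℕ → A} (hx : IsRecurrentSeq x) {n m l : ℕ}
    (h : m ≤ n) (hl : 2 * l ≤ m) (v : Fin m → A) :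
    #{w ∈ rightSpecial x n | suffixWord h w = v} * (l + 1) ≤ #(factors x (n + 1 + l)) := by
  choose! p hp using fun w (hw : w ∈ rightSpecial x n) => exists_not_hasShortPeriodAt hx h l hw
  rw [← card_range (l + 1), ← card_product]
  have key : ∀ w ∈ rightSpecial x n, suffixWord h w = v → ∀ w' ∈ rightSpecial x n,
      suffixWord h w' = v → ∀ k ≤ l, ∀ k' ≤ l,
      factorAt x (n + 1 + l) (p w - k) = factorAt x (n + 1 + l) (p w' - k') → ¬ k < k' := by
    intro w hw hwv w' hw' hwv' k hk k' hk' heq hlt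
    obtain ⟨h1, h2, h3⟩ := hp w hw
    obtain ⟨h1', h2', -⟩ := hp w' hw'
    rw [factorAt_eq_iff] at heq
    have hs : factorAt x m (p w + (n - m)) = factorAt x m (p w' + (n - m)) := by
      rw [← suffixWord_factorAt h, ← suffixWord_factorAt h, h2, h2', hwv, hwv']
    rw [factorAt_eq_iff] at hs
    refine h3 ⟨k' - k, by omega, by omega, fun s hsm => ?_⟩
    have := heq (k + (n - m) + s + (k' - k)) (by omega)
    rw [show p w - k + (k + (n - m) + s + (k' - k)) = p w + (n - m) + s + (k' - k) by omega,
      show p w' - k' + (k + (n - m) + s + (k' - k)) = p w' + (n - m) + s by omega] at this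
    rw [this, hs s (by omega)]
  refine card_le_card_of_injOn (fun q => factorAt x (n + 1 + l) (p q.1 - q.2))
    (fun q _ => mem_factors.2 ⟨_, rfl⟩) ?_
  rintro ⟨w, k⟩ hq ⟨w', k'⟩ hq' heq
  simp only [coe_product, Set.mem_prod, mem_coe, mem_filter, mem_range] at hq hq' heq
  obtain ⟨⟨hw, hwv⟩, hk⟩ := hq
  obtain ⟨⟨hw', hwv'⟩, hk'⟩ := hq'
  have e1 := key w hw hwv w' hw' hwv' k (by omega) k' (by omega) heq
  have e2 := key w' hw' hwv' w hw hwv k' (by omega) k (by omega) heq.symm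
  obtain rfl : k = k' := by omega
  obtain ⟨h1, h2, -⟩ := hp w hw
  obtain ⟨h1', h2', -⟩ := hp w' hw'
  have : w = w' := by
    rw [← h2, ← h2', factorAt_eq_iff]
    intro t ht
    have := factorAt_eq_iff.1 heq (k + t) (by omega)
    rwa [← add_assoc, ← add_assoc, Nat.sub_add_cancel (by omega),
      Nat.sub_add_cancel (by omega)] at this
  rw [this]

open Finset in
theorem exists_card_rightSpecial_le {x : ℕ → A} {C : ℕ}
    (hC : ∀ n, 1 ≤ n → #(factors x n) ≤ C * n) (n : ℕ) :
    ∃ m ≤ n, n ≤ 2 * m ∧ #(rightSpecial x m) ≤ 2 * C := by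
  by_contra! hcon
  have grow : ∀ k, (n + 1) / 2 + k ≤ n + 1 →
      k * (2 * C + 1) ≤ #(factors x ((n + 1) / 2 + k)) := by
    intro k
    induction k with
    | zero => simp
    | succ k ih =>
      intro hk
      have a1 := ih (by omega)
      have a2 := hcon ((n + 1) / 2 + k) (by omega) (by omega)
      have a3 := card_factors_add_card_rightSpecial_le x ((n + 1) / 2 + k)
      rw [add_one_mul, ← add_assoc ((n + 1) / 2)]
      omega
  have a1 := grow (n / 2 + 1) (by omega)
  rw [show (n + 1) / 2 + (n / 2 + 1) = n + 1 by omega] at a1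
  have a2 := hC (n + 1) (by omega)
  have a3 : C * (n + 1) ≤ C * (2 * (n / 2 + 1)) := Nat.mul_le_mul_left _ (by omega)
  have a4 : (n / 2 + 1) * (2 * C + 1) = C * (2 * (n / 2 + 1)) + (n / 2 + 1) := by ring
  omega

open Finset in
/-- **Cassaigne's theorem**: a recurrent sequence of sublinear complexity has a bounded number of
right special factors of each length. -/
theorem card_rightSpecial_le {x : ℕ → A} (hx : IsRecurrentSeq x) {C : ℕ}
    (hC : ∀ n, 1 ≤ n → #(factors x n) ≤ C * n) (n : ℕ) :
    #(rightSpecial x n) ≤ 8 * C * (2 * C) := by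
  classical
  obtain ⟨m, hm, hnm, hR⟩ := exists_card_rightSpecial_le hC n
  refine (card_le_mul_card_image_of_maps_to (f := suffixWord hm) (t := rightSpecial x m)
    (fun w hw => suffixWord_mem_rightSpecial hm hw) (8 * C) fun v _ => ?_).trans
      (Nat.mul_le_mul_left _ hR)
  have a1 := card_rightSpecial_fiber_mul_le hx hm (l := m / 2) (by omega) v
  have a2 := hC (n + 1 + m / 2) (by omega)
  have a3 : C * (n + 1 + m / 2) ≤ C * (8 * (m / 2 + 1)) := Nat.mul_le_mul_left _ (by omega)
  refine Nat.le_of_mul_le_mul_right (c := m / 2 + 1) ?_ (by omega)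
  calc _ ≤ C * (8 * (m / 2 + 1)) := a1.trans (a2.trans a3)
    _ = _ := by ring

end Factors

theorem iterate_shiftN {A : Type*} (x : ℕ → A) (n k : ℕ) : shiftN^[n] x k = x (n + k) := by
  induction n generalizing x with
  | zero => simp
  | succ n ih =>
    rw [Function.iterate_succ_apply, ih, shiftN]
    congr 1
    omega

theorem MinimalN.exists_eq {A : Type*} [TopologicalSpace A] [DiscreteTopology A]
    {X : Set (ℕ → A)} (hmin : MinimalN X) (hinv : ∀ x ∈ X, shiftN x ∈ X) {x y : ℕ → A}
    (hx : x ∈ X) (hy : y ∈ X) (n i N : ℕ) :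
    ∃ j, N ≤ j ∧ ∀ k < n, x (j + k) = y (i + k) := by
  have hit : ∀ z ∈ X, ∀ k, shiftN^[k] z ∈ X := fun z hz k => by
    induction k with
    | zero => exact hz
    | succ k ih => rw [Function.iterate_succ_apply']; exact hinv _ ih
  have hopen : IsOpen {z : ℕ → A | ∀ k < n, z k = y (i + k)} := by
    have : {z : ℕ → A | ∀ k < n, z k = y (i + k)} =
        (↑(Finset.range n) : Set ℕ).pi fun k => {y (i + k)} := by
      ext z
      simp [Set.mem_pi]
    rw [this]
    exact isOpen_set_pi (Finset.finite_toSet _) fun _ _ => isOpen_discrete _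
  obtain ⟨z, hz, j, rfl⟩ := mem_closure_iff.1 (hmin _ (hit x hx N) (hit y hy i)) _ hopen
    fun k _ => iterate_shiftN y i k
  refine ⟨N + j, by omega, fun k hk => ?_⟩
  have := hz k hk
  rwa [iterate_shiftN, iterate_shiftN, ← add_assoc] at this

theorem complexityN_eq_card_factors {A : Type*} [Fintype A] [TopologicalSpace A]
    [DiscreteTopology A] {X : Set (ℕ → A)} (hmin : MinimalN X) (hinv : ∀ x ∈ X, shiftN x ∈ X)
    {x : ℕ → A} (hx : x ∈ X) (n : ℕ) : complexityN X n = (factors x n).card := by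
  have : {w : Fin n → A | ∃ x ∈ X, ∃ i : ℕ, ∀ j : Fin n, w j = x (i + (j : ℕ))} =
      ↑(factors x n) := by
    ext w
    simp only [Set.mem_ofPred_eq, Finset.mem_coe, mem_factors]
    constructor
    · rintro ⟨y, hy, i, hw⟩
      obtain ⟨j, -, hj⟩ := hmin.exists_eq hinv hx hy n i 0
      exact ⟨j, funext fun k => (hj k k.2).trans (hw k).symm⟩
    · rintro ⟨i, rfl⟩
      exact ⟨x, hx, i, fun _ => rfl⟩
  rw [complexityN, this]
  simp

/-- An infinite minimal one-sided shift has sublinear complexity iff its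
complexity difference function is bounded: there is `L` with `p(n+1) ≤ p(n) + L` for all
`n ≥ 1`. -/
theorem sublinear_iff_bounded_difference
    {A : Type*} [Fintype A] [TopologicalSpace A] [DiscreteTopology A]
    (X : Set (ℕ → A)) (hne : X.Nonempty) (hclosed : IsClosed X)
    (hinv : ∀ x ∈ X, shiftN x ∈ X)
    (hmin : MinimalN X) (hinf : X.Infinite) :
    SublinearComplexityN X ↔
      ∃ L : ℕ, ∀ n : ℕ, 1 ≤ n → complexityN X (n + 1) ≤ complexityN X n + L := by
  obtain ⟨x, hx⟩ := hne
  constructor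
  · rintro ⟨C, hC⟩
    simp only [complexityN_eq_card_factors hmin hinv hx] at hC ⊢
    have hrec : IsRecurrentSeq x := fun n i N =>
      (hmin.exists_eq hinv hx hx n i N).imp fun j hj => ⟨hj.1, factorAt_eq_iff.2 hj.2⟩
    exact ⟨Fintype.card A * (8 * C * (2 * C)), fun n _ => (card_factors_succ_le x n).trans
      (Nat.add_le_add_left (Nat.mul_le_mul_left _ (card_rightSpecial_le hrec hC n)) _)⟩
  · rintro ⟨L, hL⟩
    refine ⟨complexityN X 1 + L, fun n hn => ?_⟩
    induction n, hn using Nat.le_induction with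
    | base => omega
    | succ n hn ih =>
      have := hL n hn
      rw [mul_add_one]
      omega
end
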